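/- Let τ ∈ ℍ be an imaginary quadratic point. Then J(τ) and 1/I(τ) are algebraic integers, i.e. integral over ℤ. -/

import Mathlib

open Complex

/-- The `q`-Pochhammer infinite product `(a; q)∞ = ∏_{n=0}^∞ (1 - a qⁿ)`. -/
noncomputable def qPoch (a q : ℂ) : ℂ := ∏' n : ℕ, (1 - a * q ^ n)

/-- The nome `q = e^{2πiτ}` of a point `τ` of the upper half-plane. -/
noncomputable def Qc (τ : UpperHalfPlane) : ℂ := Complex.exp (2 * Real.pi * Complex.I * τ)

/-- A point `τ ∈ ℍ` is an imaginary quadratic point if `aτ² + bτ + c = 0` for some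
integers `a, b, c` with `a ≠ 0`. -/
def IsImagQuadratic (τ : UpperHalfPlane) : Prop :=
  ∃ a b c : ℤ, a ≠ 0 ∧ (a : ℂ) * (τ : ℂ) ^ 2 + (b : ℂ) * (τ : ℂ) + (c : ℂ) = 0

/-- `I(τ) = q^{3/4}(q;q¹⁰)∞(q⁹;q¹⁰)∞ / ((q⁴;q¹⁰)∞(q⁶;q¹⁰)∞)` with `q^{3/4} = e^{2πiτ·(3/4)}`. -/
noncomputable def Ifun (τ : UpperHalfPlane) : ℂ :=
  Complex.exp (2 * Real.pi * Complex.I * τ * (3 / 4)) *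
    (qPoch (Qc τ) (Qc τ ^ 10) * qPoch (Qc τ ^ 9) (Qc τ ^ 10)) /
    (qPoch (Qc τ ^ 4) (Qc τ ^ 10) * qPoch (Qc τ ^ 6) (Qc τ ^ 10))

/-- `J(τ) = q^{1/4}(q²;q¹⁰)∞(q⁸;q¹⁰)∞ / ((q³;q¹⁰)∞(q⁷;q¹⁰)∞)` with `q^{1/4} = e^{2πiτ·(1/4)}`. -/
noncomputable def Jfun (τ : UpperHalfPlane) : ℂ :=
  Complex.exp (2 * Real.pi * Complex.I * τ * (1 / 4)) *
    (qPoch (Qc τ ^ 2) (Qc τ ^ 10) * qPoch (Qc τ ^ 8) (Qc τ ^ 10)) /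
    (qPoch (Qc τ ^ 3) (Qc τ ^ 10) * qPoch (Qc τ ^ 7) (Qc τ ^ 10))

section Part1
open Complex

/-- The power series `P` converges to `F` on the open unit disc. -/
def RepC (P : PowerSeries ℂ) (F : ℂ → ℂ) : Prop :=
  ∀ z : ℂ, ‖z‖ < 1 → HasSum (fun n => P.coeff n * z ^ n) (F z)

lemma RepC.congr {P : PowerSeries ℂ} {F G : ℂ → ℂ} (h : RepC P F)
    (hFG : ∀ z, ‖z‖ < 1 → F z = G z) : RepC P G := fun z hz => hFG z hz ▸ h z hz

lemma RepC.add {P Q : PowerSeries ℂ} {F G : ℂ → ℂ} (hP : RepC P F) (hQ : RepC Q G) :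
    RepC (P + Q) (fun z => F z + G z) := fun z hz => by
  simpa [add_mul] using (hP z hz).add (hQ z hz)

lemma RepC.mul {P Q : PowerSeries ℂ} {F G : ℂ → ℂ} (hP : RepC P F) (hQ : RepC Q G) :
    RepC (P * Q) (fun z => F z * G z) := fun z hz => by
  have h1 := hP z hz
  have h2 := hQ z hz
  have h3 := (summable_norm_sum_mul_antidiagonal_of_summable_norm h1.summable.norm
    h2.summable.norm).of_norm.hasSum
  rw [← tsum_mul_tsum_eq_tsum_sum_antidiagonal_of_summable_norm h1.summable.norm
    h2.summable.norm, h1.tsum_eq, h2.tsum_eq] at h3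
  have h4 : (fun n => (P * Q).coeff n * z ^ n) = fun n => ∑ kl ∈ Finset.HasAntidiagonal.antidiagonal n,
      P.coeff kl.1 * z ^ kl.1 * (Q.coeff kl.2 * z ^ kl.2) := by
    funext n
    rw [PowerSeries.coeff_mul, Finset.sum_mul]
    refine Finset.sum_congr rfl fun ij hij => ?_
    rw [← Finset.HasAntidiagonal.mem_antidiagonal.mp hij, pow_add]
    ring
  rw [h4]
  exact h3

lemma RepC.const (c : ℂ) : RepC (PowerSeries.C c) (fun _ => c) := fun z _ => by
  convert hasSum_ite_eq 0 c using 2 with n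
  rw [PowerSeries.coeff_C]
  split_ifs with h <;> simp [h]

lemma RepC.X : RepC PowerSeries.X (fun z => z) := fun z _ => by
  convert hasSum_ite_eq 1 z using 2 with n
  rw [PowerSeries.coeff_X]
  split_ifs with h <;> simp [h]

lemma RepC.zero_eval {P : PowerSeries ℂ} {F : ℂ → ℂ} (hP : RepC P F) :
    F 0 = PowerSeries.constantCoeff P := by
  have h := hP 0 (by simp)
  have h2 : HasSum (fun n => P.coeff n * (0 : ℂ) ^ n) (P.coeff 0) := by
    convert hasSum_ite_eq 0 (P.coeff 0) using 2 with n
    split_ifs with h <;> simp [h]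
  simpa using h.unique h2

lemma RepC.hasFPowerSeries {P : PowerSeries ℂ} {F : ℂ → ℂ} (hP : RepC P F) :
    HasFPowerSeriesOnBall F (FormalMultilinearSeries.ofScalars ℂ (fun n => P.coeff n)) 0 1 where
  r_le := by
    refine ENNReal.le_of_forall_nnreal_lt fun r hr => ?_
    refine FormalMultilinearSeries.le_radius_of_summable_norm _ ?_
    have h := (hP (r : ℂ) (by simpa using hr)).summable.norm
    refine h.congr fun n => ?_
    simp
  r_pos := by norm_num
  hasSum := fun {y} hy => by
    have hy' : ‖y‖ < 1 := by
      simpa [Metric.eball, edist_zero_right, enorm, ← NNReal.coe_lt_one] using hy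
    have := hP y hy'
    simpa [FormalMultilinearSeries.ofScalars_apply_eq, smul_eq_mul, mul_comm] using this

lemma RepC.differentiableOn {P : PowerSeries ℂ} {F : ℂ → ℂ} (hP : RepC P F) :
    DifferentiableOn ℂ F (Metric.ball 0 1) := by
  have := hP.hasFPowerSeries.differentiableOn
  have h2 : Metric.eball (0 : ℂ) 1 = Metric.ball 0 1 := by
    simpa using Metric.eball_ofReal (x := (0 : ℂ)) (ε := 1)
  rwa [h2] at this

lemma RepC.unique {P Q : PowerSeries ℂ} {F : ℂ → ℂ} (hP : RepC P F) (hQ : RepC Q F) : P = Q := by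
  have h := hP.hasFPowerSeries.hasFPowerSeriesAt.eq_formalMultilinearSeries
    hQ.hasFPowerSeries.hasFPowerSeriesAt
  ext n
  have := congrArg (fun p => p.coeff n) h
  simpa [FormalMultilinearSeries.coeff_ofScalars] using this

lemma RepC.of_differentiableOn {F : ℂ → ℂ} (hF : DifferentiableOn ℂ F (Metric.ball 0 1)) :
    ∃ P, RepC P F := by
  refine ⟨PowerSeries.mk fun n => ((n.factorial : ℂ)⁻¹ * iteratedDeriv n F 0), fun z hz => ?_⟩
  have := Complex.hasSum_taylorSeries_on_ball hF (z := z) (by simpa using hz)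
  have h4 : (fun n => (PowerSeries.mk fun n => ((n.factorial : ℂ)⁻¹ * iteratedDeriv n F 0)).coeff n
      * z ^ n) = fun n : ℕ => (n.factorial : ℂ)⁻¹ • (z - 0) ^ n • iteratedDeriv n F 0 := by
    funext n
    simp only [PowerSeries.coeff_mk, smul_eq_mul, sub_zero]
    ring
  rw [h4]
  exact this

lemma RepC.of_differentiableOn_coeff {P : PowerSeries ℂ} {F : ℂ → ℂ} (hP : RepC P F) (n : ℕ) :
    P.coeff n = (n.factorial : ℂ)⁻¹ * iteratedDeriv n F 0 := by
  have hF := hP.differentiableOn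
  have : RepC (PowerSeries.mk fun n => ((n.factorial : ℂ)⁻¹ * iteratedDeriv n F 0)) F := by
    intro z hz
    have := Complex.hasSum_taylorSeries_on_ball hF (z := z) (by simpa using hz)
    have h4 : (fun n => (PowerSeries.mk fun n =>
        ((n.factorial : ℂ)⁻¹ * iteratedDeriv n F 0)).coeff n
        * z ^ n) = fun n : ℕ => (n.factorial : ℂ)⁻¹ • (z - 0) ^ n • iteratedDeriv n F 0 := by
      funext n
      simp only [PowerSeries.coeff_mk, smul_eq_mul, sub_zero]
      ring
    rw [h4]
    exact this
  rw [hP.unique this, PowerSeries.coeff_mk]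

/-- The ring of algebraic integers. -/
abbrev SInt : Subalgebra ℤ ℂ := integralClosure ℤ ℂ

/-- The power series `P` with algebraic integer coefficients converges to `F` on the disc. -/
def RepS (P : PowerSeries SInt) (F : ℂ → ℂ) : Prop :=
  RepC (P.map (algebraMap SInt ℂ)) F

lemma RepS.congr {P : PowerSeries SInt} {F G : ℂ → ℂ} (h : RepS P F)
    (hFG : ∀ z, ‖z‖ < 1 → F z = G z) : RepS P G := RepC.congr h hFG

lemma RepS.add {P Q : PowerSeries SInt} {F G : ℂ → ℂ} (hP : RepS P F) (hQ : RepS Q G) :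
    RepS (P + Q) (fun z => F z + G z) := by
  unfold RepS
  rw [map_add]
  exact RepC.add hP hQ

lemma RepS.mul {P Q : PowerSeries SInt} {F G : ℂ → ℂ} (hP : RepS P F) (hQ : RepS Q G) :
    RepS (P * Q) (fun z => F z * G z) := by
  unfold RepS
  rw [map_mul]
  exact RepC.mul hP hQ

lemma RepS.const (c : SInt) : RepS (PowerSeries.C c) (fun _ => (c : ℂ)) := by
  unfold RepS
  rw [PowerSeries.map_C]
  exact RepC.const _

lemma RepS.X : RepS PowerSeries.X (fun z => z) := by
  unfold RepS
  rw [PowerSeries.map_X]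
  exact RepC.X

lemma RepS.zero_eval {P : PowerSeries SInt} {F : ℂ → ℂ} (hP : RepS P F) :
    F 0 = ((PowerSeries.constantCoeff P : SInt) : ℂ) := by
  rw [RepC.zero_eval hP]
  rw [← PowerSeries.coeff_zero_eq_constantCoeff_apply, PowerSeries.coeff_map,
    PowerSeries.coeff_zero_eq_constantCoeff_apply]
  rfl

lemma RepS.inv {P : PowerSeries SInt} {F : ℂ → ℂ} (hP : RepS P F)
    (hu : IsUnit (PowerSeries.constantCoeff P)) (hF : ∀ z, ‖z‖ < 1 → F z ≠ 0) :
    ∃ Q, P * Q = 1 ∧ RepS Q (fun z => (F z)⁻¹) := by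
  have h1 : IsUnit P := PowerSeries.isUnit_iff_constantCoeff.mpr hu
  obtain ⟨Q, hQ⟩ := h1.exists_right_inv
  refine ⟨Q, hQ, ?_⟩
  obtain ⟨B, hB⟩ := RepC.of_differentiableOn (F := fun z => (F z)⁻¹)
    ((RepC.differentiableOn hP).inv fun z hz => hF z (by simpa using hz))
  have h2 : RepC (P.map (algebraMap SInt ℂ) * B) (fun _ => 1) :=
    (RepC.mul hP hB).congr fun z hz => mul_inv_cancel₀ (hF z hz)
  have h3 : P.map (algebraMap SInt ℂ) * B = 1 := by
    rw [h2.unique (RepC.const 1), map_one]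
  have h4 : Q.map (algebraMap SInt ℂ) = B := by
    have h5 : Q.map (algebraMap SInt ℂ) * P.map (algebraMap SInt ℂ) = 1 := by
      rw [← map_mul, mul_comm, hQ, map_one]
    calc _ = Q.map (algebraMap SInt ℂ) * (P.map (algebraMap SInt ℂ) * B) := by rw [h3, mul_one]
      _ = B := by rw [← mul_assoc, h5, one_mul]
  unfold RepS
  rwa [h4]

/-- Re-indexing: a sum of monomials with finite-to-one exponents. -/
lemma RepS.of_hasSum {β : Type*} (e : β → ℕ) (he : ∀ n, (e ⁻¹' {n}).Finite) (a : β → SInt)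
    {F : ℂ → ℂ} (h : ∀ z, ‖z‖ < 1 → HasSum (fun b => (a b : ℂ) * z ^ e b) (F z)) :
    RepS (PowerSeries.mk fun n => ∑ b ∈ (he n).toFinset, a b) F := by
  intro z hz
  have h1 := h z hz
  rw [← (Equiv.sigmaFiberEquiv e).hasSum_iff] at h1
  have h2 := h1.sigma (g := fun n => ((∑ b ∈ (he n).toFinset, a b : SInt) : ℂ) * z ^ n) ?_
  · simpa using h2
  · intro n
    let _ : Fintype {b // e b = n} := (he n).fintype
    have h4 := hasSum_fintype (fun b : {b // e b = n} =>
      ((fun b => (a b : ℂ) * z ^ e b) ∘ (Equiv.sigmaFiberEquiv e)) ⟨n, b⟩)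
    have h3 : ∀ b, b ∈ (he n).toFinset ↔ e b = n := by simp
    have h5 : ((∑ b ∈ (he n).toFinset, a b : SInt) : ℂ) * z ^ n = ∑ b : {b // e b = n},
      ((fun b => (a b : ℂ) * z ^ e b) ∘ (Equiv.sigmaFiberEquiv e)) ⟨n, b⟩ := by
      push_cast
      rw [Finset.sum_mul, Finset.sum_subtype _ h3]
      refine Finset.sum_congr rfl fun b _ => ?_
      simp only [Function.comp, Equiv.sigmaFiberEquiv, Equiv.coe_fn_mk]
      rw [b.2]
    rw [h5]
    exact h4

/-- Substitution of `ζ z ^ e`. -/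
lemma RepS.subst {P : PowerSeries SInt} {F : ℂ → ℂ} (hP : RepS P F) (ζ : SInt) (hζ : ‖(ζ : ℂ)‖ = 1)
    (e : ℕ) (he : 0 < e) :
    ∃ Q, PowerSeries.constantCoeff Q = PowerSeries.constantCoeff P ∧
      RepS Q (fun z => F (ζ * z ^ e)) := by
  have hf : ∀ n, ((fun m : ℕ => e * m) ⁻¹' {n}).Finite := fun n =>
    (Set.finite_singleton n).preimage (fun a _ b _ h => Nat.eq_of_mul_eq_mul_left he h)
  refine ⟨_, ?_, RepS.of_hasSum (fun n => e * n) hf (fun n => P.coeff n * ζ ^ n) ?_⟩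
  · rw [← PowerSeries.coeff_zero_eq_constantCoeff_apply, PowerSeries.coeff_mk]
    have : (hf 0).toFinset = {0} := by
      ext x
      simp [he.ne']
    rw [this]
    simp
  · intro z hz
    have h1 : ‖(ζ : ℂ) * z ^ e‖ < 1 := by
      rw [norm_mul, hζ, one_mul, norm_pow]
      exact pow_lt_one₀ (norm_nonneg _) hz he.ne'
    have h2 := hP _ h1
    convert h2 using 2 with n
    rw [PowerSeries.coeff_map]
    push_cast
    rw [mul_pow, ← pow_mul, mul_assoc]
    rfl

/-- Division by `X`. -/
lemma RepS.shift {P : PowerSeries SInt} {F : ℂ → ℂ} (hP : RepS P F)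
    (h0 : PowerSeries.constantCoeff P = 0) :
    ∃ Q G, RepS Q G ∧ ∀ z, ‖z‖ < 1 → F z = z * G z := by
  obtain ⟨Q, hQ⟩ := PowerSeries.X_dvd_iff.mpr h0
  have h1 : ∀ z : ℂ, ‖z‖ < 1 → HasSum (fun n => (Q.map (algebraMap SInt ℂ)).coeff n * z ^ n)
      (∑' n, (Q.map (algebraMap SInt ℂ)).coeff n * z ^ n) := by
    intro z hz
    apply Summable.hasSum
    have h2 := (hP z hz).summable
    rw [hQ, ← summable_nat_add_iff 1] at h2
    by_cases hz0 : z = 0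
    · subst hz0
      refine summable_of_ne_finset_zero (s := {0}) fun b hb => ?_
      simp at hb
      simp [hb]
    · have h3 := h2.mul_left z⁻¹
      refine h3.congr fun n => ?_
      simp only [map_mul, PowerSeries.map_X, PowerSeries.coeff_succ_X_mul]
      field_simp
      ring
  refine ⟨Q, _, h1, fun z hz => ?_⟩
  have h4 : RepS P (fun z => z * ∑' n, (Q.map (algebraMap SInt ℂ)).coeff n * z ^ n) := by
    rw [hQ]
    exact RepS.X.mul h1
  exact (hP z hz).unique (h4 z hz)

end Part1

section Part2
open Complex

/-- The local parameter `exp (2πiτ/N)`. -/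
noncomputable def qN (N : ℕ) (τ : UpperHalfPlane) : ℂ :=
  Complex.exp (2 * Real.pi * Complex.I * τ / N)

lemma qN_ne_zero (N : ℕ) (τ : UpperHalfPlane) : qN N τ ≠ 0 := Complex.exp_ne_zero _

lemma norm_qN (N : ℕ) (τ : UpperHalfPlane) : ‖qN N τ‖ = Real.exp (-2 * Real.pi * τ.im / N) := by
  rw [qN, Complex.norm_exp]
  congr 1
  rw [Complex.div_natCast_re]
  simp

lemma norm_qN_lt {N : ℕ} (hN : 0 < N) (τ : UpperHalfPlane) : ‖qN N τ‖ < 1 := by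
  rw [norm_qN, Real.exp_lt_one_iff]
  have : 0 < τ.im := τ.im_pos
  have h2 : (0 : ℝ) < N := by exact_mod_cast hN
  have h3 := Real.pi_pos
  apply div_neg_of_neg_of_pos _ h2
  nlinarith [mul_pos h3 this]

lemma exists_qN {N : ℕ} (hN : 0 < N) {z : ℂ} (hz : ‖z‖ < 1) (h0 : z ≠ 0) : ∃ τ, qN N τ = z := by
  have hN' : (N : ℂ) ≠ 0 := by exact_mod_cast hN.ne'
  have hN2 : (0 : ℝ) < N := by exact_mod_cast hN
  have hpi := Real.pi_pos
  have him : 0 < (Complex.log z * N / (2 * Real.pi * Complex.I)).im := by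
    have h1 : Complex.log z * N / (2 * Real.pi * Complex.I)
        = ((N / (2 * Real.pi) : ℝ) : ℂ) * (-Complex.I * Complex.log z) := by
      have : (Real.pi : ℂ) ≠ 0 := by exact_mod_cast hpi.ne'
      push_cast
      field_simp
      rw [I_sq]
      ring
    rw [h1, Complex.im_ofReal_mul]
    apply mul_pos (by positivity)
    simp [Complex.log_re]
    exact Real.log_neg (norm_pos_iff.mpr h0) hz
  refine ⟨⟨_, him⟩, ?_⟩
  rw [qN]
  have : (Real.pi : ℂ) ≠ 0 := by exact_mod_cast hpi.ne'
  conv_rhs => rw [← Complex.exp_log h0]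
  congr 1
  change 2 * Real.pi * Complex.I * (Complex.log z * N / (2 * Real.pi * Complex.I)) / N = _
  have hI := Complex.I_ne_zero
  field_simp

/-- `f` has a `q`-expansion with algebraic integer coefficients: `f q^k` is a power series with
constant term `c`. -/
def Good (N : ℕ) (k : ℤ) (c : SInt) (f : UpperHalfPlane → ℂ) : Prop :=
  ∃ (P : PowerSeries SInt) (F : ℂ → ℂ), RepS P F ∧ PowerSeries.constantCoeff P = c ∧
    ∀ τ, f τ * qN N τ ^ k = F (qN N τ)

section
variable {N : ℕ} {k l : ℤ} {c d : SInt} {f g : UpperHalfPlane → ℂ}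

lemma Good.mul (hf : Good N k c f) (hg : Good N l d g) : Good N (k + l) (c * d) (f * g) := by
  obtain ⟨P, F, h1, h2, h3⟩ := hf
  obtain ⟨Q, G, g1, g2, g3⟩ := hg
  refine ⟨P * Q, _, h1.mul g1, by rw [map_mul, h2, g2], fun τ => ?_⟩
  rw [zpow_add₀ (qN_ne_zero _ _), ← h3, ← g3, Pi.mul_apply]
  ring

lemma Good.add (hf : Good N k c f) (hg : Good N k d g) : Good N k (c + d) (f + g) := by
  obtain ⟨P, F, h1, h2, h3⟩ := hf
  obtain ⟨Q, G, g1, g2, g3⟩ := hg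
  refine ⟨P + Q, _, h1.add g1, by rw [map_add, h2, g2], fun τ => ?_⟩
  rw [← h3, ← g3, Pi.add_apply]
  ring

lemma Good.const (N : ℕ) (c : SInt) : Good N 0 c (fun _ => (c : ℂ)) :=
  ⟨PowerSeries.C c, _, RepS.const c, by simp, fun τ => by simp⟩

lemma Good.one (N : ℕ) : Good N 0 1 1 := by
  have h : (1 : UpperHalfPlane → ℂ) = fun _ => ((1 : SInt) : ℂ) := by ext; simp
  rw [h]
  exact Good.const N 1

lemma Good.zero (N : ℕ) : Good N 0 0 0 := by
  have h : (0 : UpperHalfPlane → ℂ) = fun _ => ((0 : SInt) : ℂ) := by ext; simp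
  rw [h]
  exact Good.const N 0

lemma Good.raise (hf : Good N k c f) {m : ℕ} (hm : 0 < m) : Good N (k + m) 0 f := by
  obtain ⟨P, F, h1, h2, h3⟩ := hf
  obtain ⟨m, rfl⟩ : ∃ n, m = n + 1 := ⟨m - 1, by omega⟩
  have h : ∀ n : ℕ, RepS (PowerSeries.X ^ n) (fun z => z ^ n) := by
    intro n
    induction n with
    | zero => simpa using RepS.const 1
    | succ n ih => simpa [pow_succ] using ih.mul RepS.X
  refine ⟨P * PowerSeries.X ^ (m + 1), _, h1.mul (h _), by simp, fun τ => ?_⟩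
  rw [zpow_add₀ (qN_ne_zero _ _), ← h3, zpow_natCast]
  ring

lemma Good.lower (hN : 0 < N) (hf : Good N k 0 f) : ∃ c, Good N (k - 1) c f := by
  obtain ⟨P, F, h1, h2, h3⟩ := hf
  obtain ⟨Q, G, h4, h5⟩ := h1.shift h2
  refine ⟨_, Q, G, h4, rfl, fun τ => ?_⟩
  have h6 := h5 (qN N τ) (norm_qN_lt hN τ)
  rw [← h3] at h6
  rw [zpow_sub_one₀ (qN_ne_zero _ _), ← mul_assoc, h6]
  field_simp [qN_ne_zero N τ]

lemma Good.inv (hN : 0 < N) (hf : Good N k c f) (u : SInt) (hu : c * u = 1) (h0 : ∀ τ, f τ ≠ 0) :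
    Good N (-k) u (fun τ => (f τ)⁻¹) := by
  obtain ⟨P, F, h1, h2, h3⟩ := hf
  have hF : ∀ z, ‖z‖ < 1 → F z ≠ 0 := by
    intro z hz
    by_cases hz0 : z = 0
    · rw [hz0, h1.zero_eval, h2]
      intro h
      have : c = 0 := by exact_mod_cast h
      rw [this, zero_mul] at hu
      exact zero_ne_one hu
    · obtain ⟨τ, rfl⟩ := exists_qN hN hz hz0
      rw [← h3]
      exact mul_ne_zero (h0 τ) (zpow_ne_zero _ (qN_ne_zero _ _))
  obtain ⟨Q, hQ, h4⟩ := h1.inv (by rw [h2]; exact IsUnit.of_mul_eq_one u hu) hF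
  refine ⟨Q, _, h4, ?_, fun τ => ?_⟩
  · have := congrArg PowerSeries.constantCoeff hQ
    rw [map_mul, h2, map_one] at this
    calc _ = u * (c * PowerSeries.constantCoeff Q) := by
          rw [← mul_assoc, mul_comm u c, hu, one_mul]
      _ = u := by rw [this, mul_one]
  · rw [← h3, mul_inv, zpow_neg]

lemma Good.comp {M : ℕ} (hf : Good N k c f) (φ : UpperHalfPlane → UpperHalfPlane)
    (ζ : SIntˣ) (hζ : ‖((ζ : SInt) : ℂ)‖ = 1) (e : ℕ) (he : 0 < e)
    (h : ∀ τ, qN N (φ τ) = (ζ : SInt) * qN M τ ^ e) :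
    Good M (k * e) (c * (ζ ^ (-k) : SIntˣ)) (fun τ => f (φ τ)) := by
  obtain ⟨P, F, h1, h2, h3⟩ := hf
  obtain ⟨Q, hQ, h4⟩ := h1.subst ζ hζ e he
  refine ⟨Q * PowerSeries.C ((ζ ^ (-k) : SIntˣ) : SInt), _, h4.mul (RepS.const _), ?_, fun τ => ?_⟩
  · simp [hQ, h2]
  · have h5 := h3 (φ τ)
    rw [h τ] at h5
    rw [← h5, mul_zpow]
    have h6 : (((ζ ^ (-k) : SIntˣ) : SInt) : ℂ) = (((ζ : SInt) : ℂ) ^ k)⁻¹ := by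
      have h7 : ((ζ ^ k : SIntˣ) : SInt) * ((ζ ^ (-k) : SIntˣ) : SInt) = 1 := by
        rw [← Units.val_mul, ← zpow_add]; simp
      have h8 := congrArg (fun x : SInt => (x : ℂ)) h7
      have h9 : (((ζ ^ k : SIntˣ) : SInt) : ℂ) = ((ζ : SInt) : ℂ) ^ k := by
        have := map_zpow (Units.map (algebraMap SInt ℂ : SInt →* ℂ)) ζ k
        have := congrArg (Units.val) this
        rw [Units.val_zpow_eq_zpow_val] at this
        exact this
      push_cast at h8
      rw [h9] at h8
      exact (eq_inv_of_mul_eq_one_right h8)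
    have hz0 : ((ζ : SInt) : ℂ) ≠ 0 := by
      intro h; rw [h] at hζ; simp at hζ
    rw [h6, mul_comm k, zpow_mul, zpow_natCast]
    have := zpow_ne_zero k hz0
    field_simp

lemma Good.pow (hf : Good N k c f) (n : ℕ) : Good N (n * k) (c ^ n) (f ^ n) := by
  induction n with
  | zero => simpa using Good.one N
  | succ n ih =>
    have := ih.mul hf
    rw [← pow_succ, ← pow_succ] at this
    convert this using 1
    push_cast; ring

lemma Good.prod {ι : Type*} (s : Finset ι) {k : ι → ℤ} {c : ι → SInt}
    {f : ι → UpperHalfPlane → ℂ} (h : ∀ i ∈ s, Good N (k i) (c i) (f i)) :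
    Good N (∑ i ∈ s, k i) (∏ i ∈ s, c i) (∏ i ∈ s, f i) := by
  classical
  induction s using Finset.induction_on with
  | empty => simpa using Good.one N
  | insert a s ha ih =>
    rw [Finset.sum_insert ha, Finset.prod_insert ha, Finset.prod_insert ha]
    exact (h a (Finset.mem_insert_self _ _)).mul (ih fun i hi => h i (Finset.mem_insert_of_mem hi))

lemma Good.neg (hf : Good N k c f) : Good N k (-c) (-f) := by
  have := (Good.const N (-1)).mul hf
  convert this using 1
  · simp
  · simp
  · ext; simp

lemma Good.sub_of_lt (hf : Good N k c f) (hg : Good N l d g) (h : l < k) : Good N k c (f - g) := by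
  have h1 := (hg.raise (m := (k - l).toNat) (by omega)).neg
  have h2 : l + ((k - l).toNat : ℤ) = k := by omega
  rw [h2] at h1
  have := hf.add h1
  rw [neg_zero, add_zero, ← sub_eq_add_neg] at this
  exact this

lemma Good.exists_of_le (hf : Good N k c f) (h : k ≤ l) : ∃ c, Good N l c f := by
  rcases h.eq_or_lt with rfl | h
  · exact ⟨c, hf⟩
  · have h1 := (hf.raise (m := (l - k).toNat) (by omega))
    have h2 : k + ((l - k).toNat : ℤ) = l := by omega
    rw [h2] at h1
    exact ⟨_, h1⟩

end

/-- The subring of functions with integral `q`-expansions. -/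
def goodRing (N : ℕ) : Subring (UpperHalfPlane → ℂ) where
  carrier := {f | ∃ k c, Good N k c f}
  mul_mem' := by
    rintro f g ⟨k, c, h⟩ ⟨l, d, h'⟩
    exact ⟨_, _, h.mul h'⟩
  one_mem' := ⟨0, 1, by simpa using Good.one N⟩
  zero_mem' := ⟨0, 0, by simpa using Good.zero N⟩
  add_mem' := by
    rintro f g ⟨k, c, h⟩ ⟨l, d, h'⟩
    obtain ⟨c', h1⟩ := h.exists_of_le (le_max_left k l)
    obtain ⟨d', h2⟩ := h'.exists_of_le (le_max_right k l)
    exact ⟨_, _, h1.add h2⟩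
  neg_mem' := by
    rintro f ⟨k, c, h⟩
    exact ⟨_, _, h.neg⟩

end Part2

section Part3
open Complex UpperHalfPlane ModularGroup MatrixGroups Filter Topology
open scoped ModularForm Manifold

/-- Invariance under the modular group, expressed by the generators. -/
def InvST (f : UpperHalfPlane → ℂ) : Prop :=
  (∀ τ : UpperHalfPlane, f (ModularGroup.S • τ) = f τ) ∧
    ∀ τ : UpperHalfPlane, f (ModularGroup.T • τ) = f τ

lemma InvST.const {f : UpperHalfPlane → ℂ} (hf : InvST f)
    (hd : MDifferentiable 𝓘(ℂ) 𝓘(ℂ) f) (hb : IsBoundedAtImInfty f) : ∃ c, ∀ τ, f τ = c := by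
  have hS : f ∣[(0 : ℤ)] ModularGroup.S = f := by
    ext τ
    rw [ModularForm.SL_slash_apply, hf.1]
    simp
  have hT : f ∣[(0 : ℤ)] ModularGroup.T = f := by
    ext τ
    rw [ModularForm.SL_slash_apply, hf.2]
    simp
  let F : ModularForm (Matrix.SpecialLinearGroup.mapGL ℝ : SL(2, ℤ) →* GL (Fin 2) ℝ).range 0 :=
    { toFun := f
      slash_action_eq' := fun A hA => by
        obtain ⟨A, rfl⟩ := hA
        exact SlashInvariantForm.slash_action_generators_SL2Z hS hT A
      holo' := hd
      bdd_at_cusps' := fun {c} hc => by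
        rw [Subgroup.IsArithmetic.isCusp_iff_isCusp_SL2Z] at hc
        rw [OnePoint.isBoundedAt_iff_forall_SL2Z hc]
        intro γ _
        rw [SlashInvariantForm.slash_action_generators_SL2Z hS hT]
        exact hb }
  obtain ⟨c, hc⟩ := ModularFormClass.levelOne_weight_zero_const F
  exact ⟨c, fun τ => congrFun hc τ⟩

section
variable {N : ℕ} {k : ℤ} {c : SInt} {f : UpperHalfPlane → ℂ}

lemma differentiable_qN_aux (N : ℕ) :
    Differentiable ℂ (fun z : ℂ => Complex.exp (2 * Real.pi * Complex.I * z / N)) := by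
  fun_prop

lemma Good.mdifferentiable (hN : 0 < N) (hf : Good N k c f) : MDifferentiable 𝓘(ℂ) 𝓘(ℂ) f := by
  obtain ⟨P, F, h1, h2, h3⟩ := hf
  rw [UpperHalfPlane.mdifferentiable_iff]
  have h4 : DifferentiableOn ℂ (fun z : ℂ =>
      F (Complex.exp (2 * Real.pi * Complex.I * z / N)) *
        (Complex.exp (2 * Real.pi * Complex.I * z / N)) ^ (-k)) {z : ℂ | 0 < z.im} := by
    apply DifferentiableOn.mul
    · refine (RepC.differentiableOn h1).comp (differentiable_qN_aux N).differentiableOn ?_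
      intro z hz
      have := norm_qN_lt hN ⟨z, hz⟩
      rw [mem_ball_zero_iff]
      exact this
    · exact (differentiable_qN_aux N).differentiableOn.zpow (Or.inl fun z _ => Complex.exp_ne_zero _)
  refine h4.congr fun z hz => ?_
  have hz' : 0 < z.im := hz
  simp only [Function.comp]
  rw [ofComplex_apply_of_im_pos hz']
  have h5 := h3 ⟨z, hz'⟩
  change _ = F (qN N ⟨z, hz'⟩) * (qN N ⟨z, hz'⟩) ^ (-k)
  rw [← h5, zpow_neg, mul_assoc, mul_inv_cancel₀ (zpow_ne_zero _ (qN_ne_zero _ _)), mul_one]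

lemma qN_tendsto (hN : 0 < N) : Tendsto (qN N) atImInfty (𝓝 0) := by
  rw [tendsto_zero_iff_norm_tendsto_zero]
  simp_rw [norm_qN]
  refine Real.tendsto_exp_atBot.comp ?_
  have h1 : Tendsto UpperHalfPlane.im atImInfty atTop := tendsto_comap
  have h2 : (0 : ℝ) < N := by exact_mod_cast hN
  have : (fun τ : UpperHalfPlane => -2 * Real.pi * τ.im / N) =
    fun τ => (-(2 * Real.pi / N)) * τ.im := by ext; ring
  rw [this]
  exact h1.const_mul_atTop_of_neg (by have := Real.pi_pos; rw [neg_lt_zero]; positivity)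

lemma Good.tendsto (hN : 0 < N) (hf : Good N k c f) :
    Tendsto (fun τ => f τ * qN N τ ^ k) atImInfty (𝓝 (c : ℂ)) := by
  obtain ⟨P, F, h1, h2, h3⟩ := hf
  simp_rw [h3]
  rw [← h2, ← h1.zero_eval]
  have h4 : ContinuousAt F 0 :=
    ((RepC.differentiableOn h1).differentiableAt (Metric.ball_mem_nhds _ one_pos)).continuousAt
  exact h4.tendsto.comp (qN_tendsto hN)

lemma Good.const_of_inv (hN : 0 < N) (hf : Good N 0 c f) (hi : InvST f) : ∀ τ, f τ = c := by
  have h1 := hf.tendsto hN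
  simp only [zpow_zero, mul_one] at h1
  have hb : IsBoundedAtImInfty f := h1.isBigO_one ℝ
  obtain ⟨a, ha⟩ := hi.const (hf.mdifferentiable hN) hb
  have h2 : Tendsto f atImInfty (𝓝 a) := by
    rw [show f = fun _ => a from funext ha]
    exact tendsto_const_nhds
  intro τ
  rw [ha, tendsto_nhds_unique h2 h1]

lemma qN_T (N : ℕ) (τ : UpperHalfPlane) :
    qN N (ModularGroup.T • τ) = qN N τ * Complex.exp (2 * Real.pi * Complex.I / N) := by
  rw [qN, qN, ← Complex.exp_add]
  congr 1
  rw [UpperHalfPlane.modular_T_smul]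
  simp
  ring

lemma Good.dvd_of_inv (hN : 0 < N) (hf : Good N k c f) (hi : InvST f) (hc : c ≠ 0) :
    (N : ℤ) ∣ k := by
  have h1 := hf.tendsto hN
  have h2 : Tendsto (fun τ : UpperHalfPlane => ModularGroup.T • τ) atImInfty atImInfty := by
    rw [atImInfty, tendsto_comap_iff]
    refine tendsto_comap.congr fun τ => ?_
    simp only [Function.comp]
    rw [UpperHalfPlane.modular_T_smul]
    simp
  have h3 := h1.comp h2
  have h4 : (fun τ => f τ * qN N τ ^ k) ∘ (fun τ : UpperHalfPlane => ModularGroup.T • τ) =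
      fun τ => (f τ * qN N τ ^ k) * Complex.exp (2 * Real.pi * Complex.I / N) ^ k := by
    ext τ
    simp only [Function.comp, hi.2, qN_T, mul_zpow]
    ring
  rw [h4] at h3
  have h5 := tendsto_nhds_unique h3 (h1.mul_const _)
  have hc' : (c : ℂ) ≠ 0 := by exact_mod_cast hc
  have h6 : Complex.exp (2 * Real.pi * Complex.I / N) ^ k = 1 := by
    apply mul_left_cancel₀ hc'
    rw [← h5, mul_one]
  exact ((Complex.isPrimitiveRoot_exp N hN.ne').zpow_eq_one_iff_dvd k).mp h6

lemma Good.lift (hf : Good N k c f) (hN : 0 < N) {M : ℕ} (hM : 0 < M) :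
    Good (N * M) (k * M) c f := by
  have := hf.comp (M := N * M) (fun τ => τ) 1 (by simp) M hM (fun τ => by
    rw [qN, qN, ← Complex.exp_nat_mul]
    simp only [Units.val_one, OneMemClass.coe_one, one_mul]
    congr 1
    have : (N : ℂ) ≠ 0 := by exact_mod_cast hN.ne'
    have : (M : ℂ) ≠ 0 := by exact_mod_cast hM.ne'
    push_cast
    field_simp)
  simpa using this

end

/-- The `q`-expansion principle. -/
lemma qexp_principle {j : UpperHalfPlane → ℂ} (hj : Good 1 1 1 j) (hji : InvST j) {N : ℕ}
    (hN : 0 < N) (n : ℕ) : ∀ (c : SInt) (f : UpperHalfPlane → ℂ), Good N n c f → InvST f →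
    ∃ p : Polynomial SInt, (∀ τ, f τ = Polynomial.aeval (j τ) p) ∧ p.natDegree * N ≤ n ∧
      (c ≠ 0 → p.natDegree * N = n ∧ p.leadingCoeff = c) := by
  induction n with
  | zero =>
    intro c f hf hi
    refine ⟨Polynomial.C c, fun τ => ?_, by simp, fun _ => by simp⟩
    rw [hf.const_of_inv hN hi τ, Polynomial.aeval_C]
    rfl
  | succ n ih =>
    intro c f hf hi
    by_cases hc : c = 0
    · subst hc
      obtain ⟨c', h1⟩ := hf.lower hN
      obtain ⟨p, h2, h3, h4⟩ := ih c' f (by simpa using h1) hi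
      exact ⟨p, h2, by omega, fun h => (h rfl).elim⟩
    · obtain ⟨m, hm⟩ := Int.natCast_dvd_natCast.mp (hf.dvd_of_inv hN hi hc)
      have h1 : Good N ((n + 1 : ℕ) : ℤ) (-c) (fun τ => ((-c : SInt) : ℂ) * j τ ^ m) := by
        have h2 := ((hj.lift one_pos hN).pow m)
        rw [one_mul] at h2
        have h3 := (Good.const N (-c)).mul h2
        rw [hm]
        convert h3 using 1
        · push_cast; ring
        · rw [one_pow, mul_one]
        · rfl
      have h2 := hf.add h1
      rw [add_neg_cancel] at h2
      obtain ⟨c', h3⟩ := h2.lower hN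
      obtain ⟨p, h4, h5, h6⟩ := ih c' _ (by simpa using h3)
        ⟨fun τ => by simp only [Pi.add_apply, hi.1, hji.1], fun τ => by
          simp only [Pi.add_apply, hi.2, hji.2]⟩
      have hd : p.natDegree < m := by
        by_contra hcon
        have : m * N ≤ p.natDegree * N := Nat.mul_le_mul_right _ (not_lt.mp hcon)
        have : N * m = m * N := mul_comm _ _
        omega
      have hdeg : (p + Polynomial.C c * Polynomial.X ^ m).natDegree = m := by
        rw [Polynomial.natDegree_add_eq_right_of_natDegree_lt]
        · exact Polynomial.natDegree_C_mul_X_pow m c hc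
        · rwa [Polynomial.natDegree_C_mul_X_pow m c hc]
      refine ⟨p + Polynomial.C c * Polynomial.X ^ m, fun τ => ?_, ?_, fun _ => ⟨?_, ?_⟩⟩
      · have h7 := h4 τ
        simp only [Pi.add_apply] at h7
        rw [map_add, ← h7, map_mul, Polynomial.aeval_C, map_pow, Polynomial.aeval_X]
        have : algebraMap SInt ℂ c = (c : ℂ) := rfl
        rw [this]
        push_cast
        ring
      · rw [hdeg, hm, mul_comm]
      · rw [hdeg, hm, mul_comm]
      · rw [Polynomial.leadingCoeff, hdeg, Polynomial.coeff_add,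
          Polynomial.coeff_eq_zero_of_natDegree_lt hd]
        simp

lemma isIntegral_of_coeff {x : ℂ} (p : Polynomial ℂ) (hp : p.Monic)
    (hc : ∀ n, IsIntegral ℤ (p.coeff n)) (hx : p.IsRoot x) : IsIntegral ℤ x := by
  have h1 : p ∈ Polynomial.lifts (algebraMap SInt ℂ) := by
    rw [Polynomial.lifts_iff_coeff_lifts]
    intro n
    exact ⟨⟨p.coeff n, hc n⟩, rfl⟩
  obtain ⟨q, hq, _, hm⟩ := Polynomial.lifts_and_degree_eq_and_monic h1 hp
  have h2 : IsIntegral SInt x := ⟨q, hm, by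
    rw [← Polynomial.eval_map, hq]
    exact hx⟩
  exact isIntegral_trans (A := SInt) x h2

lemma isIntegral_aeval {x : ℂ} (hx : IsIntegral ℤ x) (p : Polynomial SInt) :
    IsIntegral ℤ (Polynomial.aeval x p) := by
  rw [Polynomial.aeval_eq_sum_range]
  refine IsIntegral.sum _ fun i _ => ?_
  rw [Algebra.smul_def]
  exact IsIntegral.mul (p.coeff i).2 (hx.pow i)

lemma integral_of_family {j : UpperHalfPlane → ℂ} (hj : Good 1 1 1 j) (hji : InvST j) {N : ℕ}
    (hN : 0 < N) {ι : Type*} [Fintype ι] (h : ι → UpperHalfPlane → ℂ)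
    (hg : ∀ i, h i ∈ goodRing N) (s t : Equiv.Perm ι)
    (hs : ∀ i τ, h i (ModularGroup.S • τ) = h (s i) τ)
    (ht : ∀ i τ, h i (ModularGroup.T • τ) = h (t i) τ)
    {τ₀ : UpperHalfPlane} (hτ : IsIntegral ℤ (j τ₀)) (i : ι) : IsIntegral ℤ (h i τ₀) := by
  let Q : Polynomial (goodRing N) := ∏ i, (Polynomial.X - Polynomial.C ⟨h i, hg i⟩)
  let ev : UpperHalfPlane → (goodRing N →+* ℂ) := fun τ =>
    (Pi.evalRingHom (fun _ : UpperHalfPlane => ℂ) τ).comp (goodRing N).subtype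
  have hev : ∀ τ, Q.map (ev τ) = ∏ i, (Polynomial.X - Polynomial.C (h i τ)) := by
    intro τ
    simp [Q, Polynomial.map_prod, ev]
  have hco : ∀ n τ, (Q.coeff n : UpperHalfPlane → ℂ) τ = (Q.map (ev τ)).coeff n := by
    intro n τ
    rw [Polynomial.coeff_map]
    rfl
  have hinv : ∀ n, InvST (Q.coeff n : UpperHalfPlane → ℂ) := by
    intro n
    constructor
    · intro τ
      rw [hco, hco, hev, hev]
      congr 1
      simp_rw [hs]
      exact Equiv.prod_comp s (fun i => Polynomial.X - Polynomial.C (h i τ))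
    · intro τ
      rw [hco, hco, hev, hev]
      congr 1
      simp_rw [ht]
      exact Equiv.prod_comp t (fun i => Polynomial.X - Polynomial.C (h i τ))
  refine isIntegral_of_coeff (Q.map (ev τ₀)) ?_ ?_ ?_
  · rw [hev]
    exact Polynomial.monic_prod_of_monic _ _ fun i _ => Polynomial.monic_X_sub_C _
  · intro n
    rw [← hco]
    obtain ⟨k, c, hk⟩ := (Q.coeff n).2
    obtain ⟨c', hk'⟩ := hk.exists_of_le (l := (k.toNat : ℤ)) (Int.self_le_toNat k)
    obtain ⟨p, hp, -⟩ := qexp_principle hj hji hN k.toNat c' _ hk' (hinv n)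
    rw [hp]
    exact isIntegral_aeval hτ p
  · rw [hev, Polynomial.IsRoot, Polynomial.eval_prod]
    exact Finset.prod_eq_zero (Finset.mem_univ i) (by simp)

end Part3

section Part4
open Complex UpperHalfPlane ModularGroup MatrixGroups Filter Topology
open scoped ModularForm Manifold

lemma Good.of_hasSum {N : ℕ} (hN : 0 < N) {f : UpperHalfPlane → ℂ} (k : ℤ) {β : Type*} (e : β → ℕ)
    (he : ∀ n, (e ⁻¹' {n}).Finite) (a : β → SInt)
    (h : ∀ τ, HasSum (fun b => (a b : ℂ) * qN N τ ^ e b) (f τ * qN N τ ^ k)) :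
    Good N k (∑ b ∈ (he 0).toFinset, a b) f := by
  refine ⟨_, fun z => ∑' b, (a b : ℂ) * z ^ e b, RepS.of_hasSum e he a ?_, ?_, ?_⟩
  · intro z hz
    apply Summable.hasSum
    by_cases hz0 : z = 0
    · subst hz0
      refine summable_of_ne_finset_zero (s := (he 0).toFinset) fun b hb => ?_
      have : e b ≠ 0 := by simpa using hb
      simp [this]
    · obtain ⟨τ, rfl⟩ := exists_qN hN hz hz0
      exact (h τ).summable
  · rw [← PowerSeries.coeff_zero_eq_constantCoeff_apply, PowerSeries.coeff_mk]
  · intro τ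
    exact (h τ).tsum_eq.symm

lemma qParam_eq (τ : UpperHalfPlane) : Function.Periodic.qParam 1 (τ : ℂ) = qN 1 τ := by
  rw [Function.Periodic.qParam, qN]
  simp

lemma E4_good : Good 1 0 1 (fun τ => ModularForm.E₄ τ) := by
  have hf : ∀ n : ℕ, ((fun m : ℕ => m) ⁻¹' {n}).Finite := fun n => by simp
  let a : ℕ → SInt := fun m => if m = 0 then 1 else 240 * ((ArithmeticFunction.sigma 3 m : ℕ) : SInt)
  have := Good.of_hasSum one_pos (f := fun τ => ModularForm.E₄ τ) 0 (fun m => m) hf a (fun τ => by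
    have h := ModularForm.hasSum_qExpansion ModularForm.E₄ (h := 1) one_pos (by simp) τ
    rw [zpow_zero, mul_one]
    have h2 : (fun m : ℕ => (a m : ℂ) * qN 1 τ ^ m) = fun m : ℕ =>
        (UpperHalfPlane.qExpansion 1 ModularForm.E₄).coeff m * Function.Periodic.qParam 1 τ ^ m := by
      funext m
      rw [qParam_eq, EisensteinSeries.E_qExpansion_coeff (by norm_num) (by decide)]
      congr 1
      simp only [a]
      split_ifs with hm
      · simp
      · rw [bernoulli_eq_bernoulli'_of_ne_one (by norm_num), bernoulli'_four]
        push_cast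
        norm_num
        exact Or.inl rfl
    rw [h2]
    exact h)
  convert this using 1
  have h0 : (hf 0).toFinset = {0} := by ext; simp
  rw [h0]
  simp [a]

/-- The integer power series property passes to locally uniform limits. -/
lemma int_coeff_of_tendsto {ι : Type*} {φ : Filter ι} [φ.NeBot] {F : ι → ℂ → ℂ} {G : ℂ → ℂ}
    (h : TendstoLocallyUniformlyOn F G φ (Metric.ball 0 1))
    (hF : ∀ i, ∃ P : PowerSeries ℤ, RepC (P.map (Int.castRingHom ℂ)) (F i)) :
    ∃ P : PowerSeries ℤ, RepC (P.map (Int.castRingHom ℂ)) G := by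
  choose P hP using hF
  have hd : ∀ i, DifferentiableOn ℂ (F i) (Metric.ball 0 1) := fun i => (hP i).differentiableOn
  have hG : DifferentiableOn ℂ G (Metric.ball 0 1) :=
    h.differentiableOn (Eventually.of_forall hd) Metric.isOpen_ball
  obtain ⟨B, hB⟩ := RepC.of_differentiableOn hG
  have hder : ∀ n, (∀ i, DifferentiableOn ℂ (iteratedDeriv n (F i)) (Metric.ball 0 1)) ∧
      TendstoLocallyUniformlyOn (fun i => iteratedDeriv n (F i)) (iteratedDeriv n G) φ
        (Metric.ball 0 1) := by
    intro n
    induction n with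
    | zero => simpa using ⟨hd, h⟩
    | succ n ih =>
      simp_rw [iteratedDeriv_succ]
      exact ⟨fun i => (ih.1 i).deriv Metric.isOpen_ball,
        ih.2.deriv (Eventually.of_forall ih.1) Metric.isOpen_ball⟩
  have hInt : ∀ n, ∃ m : ℤ, B.coeff n = m := by
    intro n
    have h1 : Tendsto (fun i => ((n.factorial : ℂ)⁻¹ * iteratedDeriv n (F i) 0)) φ
        (𝓝 ((n.factorial : ℂ)⁻¹ * iteratedDeriv n G 0)) :=
      ((hder n).2.tendsto_at (by simp)).const_mul _
    rw [← hB.of_differentiableOn_coeff n] at h1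
    have hc : IsClosed (Set.range (fun m : ℤ => (m : ℂ))) := by
      have h2 : (fun m : ℤ => (m : ℂ)) = (fun x : ℝ => (x : ℂ)) ∘ (fun m : ℤ => (m : ℝ)) := by
        ext; simp
      rw [h2]
      exact (Complex.isometry_ofReal.isClosedEmbedding.comp Int.isClosedEmbedding_coe_real).isClosed_range
    have h2 := hc.mem_of_tendsto h1 (Eventually.of_forall fun i => by
      rw [← (hP i).of_differentiableOn_coeff n]
      exact ⟨(P i).coeff n, by simp⟩)
    obtain ⟨m, hm⟩ := h2
    exact ⟨m, hm.symm⟩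
  choose m hm using hInt
  refine ⟨PowerSeries.mk m, ?_⟩
  convert hB using 1
  ext n
  simp [hm]

lemma euler_rep : ∃ P : PowerSeries SInt, PowerSeries.constantCoeff P = 1 ∧
    RepS P (fun z => ∏' n : ℕ, (1 - z ^ (n + 1))) := by
  have h := ModularForm.multipliableLocallyUniformlyOn_one_sub_pow.hasProdLocallyUniformlyOn
  obtain ⟨P, hP⟩ := int_coeff_of_tendsto (φ := atTop) h (fun s => by
    induction s using Finset.induction_on with
    | empty =>
      refine ⟨1, ?_⟩
      have := RepC.const 1
      simp only [map_one] at this ⊢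
      exact this.congr (fun z _ => by simp)
    | insert a s ha ih =>
      obtain ⟨P, hP⟩ := ih
      have hX : ∀ n : ℕ, RepC (PowerSeries.X ^ n) (fun z => z ^ n) := by
        intro n
        induction n with
        | zero => simpa using RepC.const 1
        | succ n ih => simpa [pow_succ] using ih.mul RepC.X
      refine ⟨(PowerSeries.C 1 + PowerSeries.C (-1) * PowerSeries.X ^ (a + 1)) * P, ?_⟩
      have h1 := (((RepC.const 1).add ((RepC.const (-1)).mul (hX (a + 1)))).mul hP)
      simp only [map_mul, map_add, PowerSeries.map_C, map_pow, PowerSeries.map_X]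
      simp only [map_one, map_neg] at h1 ⊢
      refine h1.congr fun z _ => ?_
      rw [Finset.prod_insert ha]
      ring)
  refine ⟨P.map (Int.castRingHom SInt), ?_, ?_⟩
  · have h1 := hP.zero_eval
    have h2 : ((PowerSeries.constantCoeff P : ℤ) : ℂ) = 1 := by
      rw [← PowerSeries.coeff_zero_eq_constantCoeff_apply, PowerSeries.coeff_map] at h1
      have h5 : ∏' n : ℕ, ((1 : ℂ) - 0 ^ (n + 1)) = 1 := by simp
      rw [h5] at h1
      rw [← PowerSeries.coeff_zero_eq_constantCoeff_apply]
      exact h1.symm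
    have h3 : PowerSeries.constantCoeff P = 1 := by exact_mod_cast h2
    rw [← PowerSeries.coeff_zero_eq_constantCoeff_apply] at h3 ⊢
    rw [PowerSeries.coeff_map, h3, map_one]
  · unfold RepS
    convert hP using 1
    ext n
    simp

lemma disc_good : Good 1 (-1) 1 ModularForm.discriminant := by
  obtain ⟨P, h1, h2⟩ := euler_rep
  have h3 : ∀ n : ℕ, RepS (P ^ n) (fun z => (∏' n : ℕ, (1 - z ^ (n + 1))) ^ n) := by
    intro n
    induction n with
    | zero => simpa using RepS.const 1
    | succ n ih => simpa [pow_succ] using ih.mul h2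
  refine ⟨P ^ 24, _, h3 24, by simp [h1], fun τ => ?_⟩
  rw [ModularForm.discriminant_eq_q_prod, qParam_eq]
  rw [← (ModularForm.multipliable_one_sub_pow (norm_qN_lt one_pos τ)).tprod_pow]
  simp only [ModularForm.eta_q, qParam_eq]
  have := qN_ne_zero 1 τ
  rw [zpow_neg_one]
  field_simp

/-- The modular `j`-function. -/
noncomputable def jfun (τ : UpperHalfPlane) : ℂ :=
  ModularForm.E₄ τ ^ 3 * (ModularForm.discriminant τ)⁻¹

lemma jfun_good : Good 1 1 1 jfun := by
  have h1 := (E4_good.pow 3).mul (disc_good.inv one_pos 1 (by simp) ModularForm.discriminant_ne_zero)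
  convert h1 using 1
  · simp
  · simp
  · rfl

lemma jfun_slash {γ : SL(2, ℤ)} (h : ModularForm.discriminant ∣[(12 : ℤ)] γ = ModularForm.discriminant)
    (τ : UpperHalfPlane) : jfun (γ • τ) = jfun τ := by
  have h1 := congrFun h τ
  have h2 : ((ModularForm.E₄ : UpperHalfPlane → ℂ) ∣[(4 : ℤ)] γ) τ = ModularForm.E₄ τ :=
    congrFun (ModularForm.E₄.slash_action_eq' γ ⟨γ, rfl⟩) τ
  rw [ModularForm.SL_slash_apply] at h1 h2
  rw [jfun, jfun, ← h1, ← h2]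
  have h3 : denom γ τ ≠ 0 := denom_ne_zero _ _
  rw [zpow_neg, zpow_neg, mul_inv, mul_pow, inv_inv, inv_pow, ← zpow_natCast (_ ^ _), ← zpow_mul]
  have h4 := zpow_ne_zero 12 h3
  field_simp
  norm_num

lemma jfun_inv : InvST jfun :=
  ⟨jfun_slash ModularForm.discriminant_S_invariant, jfun_slash ModularForm.discriminant_T_invariant⟩

end Part4

section Part5
open Complex UpperHalfPlane ModularGroup MatrixGroups Filter Topology
open scoped ModularForm Manifold

lemma jfun_SL (γ : SL(2, ℤ)) (τ : UpperHalfPlane) : jfun (γ • τ) = jfun τ :=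
  jfun_slash (SlashInvariantForm.slash_action_generators_SL2Z
    ModularForm.discriminant_S_invariant ModularForm.discriminant_T_invariant γ) τ

/-- Integral matrices of determinant `m`. -/
abbrev DMat (m : ℤ) := FixedDetMatrix (Fin 2) ℤ m

/-- An integral matrix of nonzero determinant as a real invertible matrix. -/
noncomputable def DMat.gl {m : ℤ} (hm : m ≠ 0) (A : DMat m) : GL (Fin 2) ℝ :=
  Matrix.GeneralLinearGroup.mkOfDetNeZero (A.1.map (Int.castRingHom ℝ)) (by
    have h := RingHom.map_det (Int.castRingHom ℝ) A.1
    rw [A.2] at h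
    have h2 : (A.1.map (Int.castRingHom ℝ)).det = (m : ℝ) := h.symm
    rw [h2]
    exact_mod_cast hm)

lemma DMat.gl_smul {m : ℤ} (hm : m ≠ 0) (γ : SL(2, ℤ)) (A : DMat m) :
    DMat.gl hm (γ • A) = Matrix.SpecialLinearGroup.mapGL ℝ γ * DMat.gl hm A := by
  apply Units.ext
  change ((γ : Matrix (Fin 2) (Fin 2) ℤ) * A.1).map (Int.castRingHom ℝ) =
    (γ : Matrix (Fin 2) (Fin 2) ℤ).map (Int.castRingHom ℝ) * A.1.map (Int.castRingHom ℝ)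
  rw [Matrix.map_mul]

/-- Right multiplication on integral matrices of determinant `m`. -/
def DMat.rmul {m : ℤ} (γ : SL(2, ℤ)) : DMat m ≃ DMat m where
  toFun A := ⟨A.1 * γ, by simp [A.2]⟩
  invFun A := ⟨A.1 * (γ⁻¹ : SL(2, ℤ)), by
    rw [Matrix.det_mul, A.2, Matrix.SpecialLinearGroup.det_coe, mul_one]⟩
  left_inv A := by
    apply FixedDetMatrices.ext'
    change A.1 * (γ : Matrix (Fin 2) (Fin 2) ℤ) * ((γ⁻¹ : SL(2, ℤ)) : Matrix (Fin 2) (Fin 2) ℤ) = A.1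
    rw [mul_assoc, ← Matrix.SpecialLinearGroup.coe_mul, mul_inv_cancel]
    simp
  right_inv A := by
    apply FixedDetMatrices.ext'
    change A.1 * ((γ⁻¹ : SL(2, ℤ)) : Matrix (Fin 2) (Fin 2) ℤ) * (γ : Matrix (Fin 2) (Fin 2) ℤ) = A.1
    rw [mul_assoc, ← Matrix.SpecialLinearGroup.coe_mul, inv_mul_cancel]
    simp

lemma DMat.gl_rmul {m : ℤ} (hm : m ≠ 0) (γ : SL(2, ℤ)) (A : DMat m) :
    DMat.gl hm (DMat.rmul γ A) = DMat.gl hm A * Matrix.SpecialLinearGroup.mapGL ℝ γ := by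
  apply Units.ext
  change (A.1 * (γ : Matrix (Fin 2) (Fin 2) ℤ)).map (Int.castRingHom ℝ) =
    A.1.map (Int.castRingHom ℝ) * (γ : Matrix (Fin 2) (Fin 2) ℤ).map (Int.castRingHom ℝ)
  rw [Matrix.map_mul]

/-- Left cosets. -/
abbrev DQ (m : ℤ) := MulAction.orbitRel.Quotient SL(2, ℤ) (DMat m)

lemma DMat.exists_rep {m : ℤ} (hm : m ≠ 0) (A : DMat m) :
    ∃ B ∈ FixedDetMatrices.reps m, ∃ γ : SL(2, ℤ), γ • B = A := by
  refine FixedDetMatrices.induction_on (C := fun A => ∃ B ∈ FixedDetMatrices.reps m,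
    ∃ γ : SL(2, ℤ), γ • B = A) hm ?_ ?_ ?_
  · intro A h1 h2 h3 h4
    exact ⟨A, ⟨h1, h2, h3, h4⟩, 1, one_smul _ _⟩
  · rintro B ⟨B', h, γ, rfl⟩
    exact ⟨B', h, ModularGroup.S * γ, mul_smul _ _ _⟩
  · rintro B ⟨B', h, γ, rfl⟩
    exact ⟨B', h, ModularGroup.T * γ, mul_smul _ _ _⟩

/-- Action of cosets on the `j`-function. -/
noncomputable def jq {m : ℤ} (hm : m ≠ 0) (τ : UpperHalfPlane) : DQ m → ℂ :=
  Quotient.lift (fun A => jfun (DMat.gl hm A • τ)) (by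
    rintro A B ⟨γ, rfl⟩
    change jfun (DMat.gl hm (γ • B) • τ) = _
    rw [DMat.gl_smul, mul_smul]
    exact jfun_SL γ _)

/-- The permutation of cosets induced by right multiplication. -/
def DQ.perm {m : ℤ} (γ : SL(2, ℤ)) : Equiv.Perm (DQ m) :=
  Quotient.congr (DMat.rmul γ) (by
    intro A B
    constructor
    · rintro ⟨δ, rfl⟩
      refine ⟨δ, ?_⟩
      apply FixedDetMatrices.ext'
      change (δ : Matrix (Fin 2) (Fin 2) ℤ) * (B.1 * _) = (δ : Matrix (Fin 2) (Fin 2) ℤ) * B.1 * _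
      rw [mul_assoc]
    · rintro ⟨δ, h⟩
      refine ⟨δ, ?_⟩
      apply (DMat.rmul γ).injective
      rw [← h]
      apply FixedDetMatrices.ext'
      change (δ : Matrix (Fin 2) (Fin 2) ℤ) * B.1 * _ = (δ : Matrix (Fin 2) (Fin 2) ℤ) * (B.1 * _)
      rw [mul_assoc])

lemma jq_perm {m : ℤ} (hm : m ≠ 0) (γ : SL(2, ℤ)) (τ : UpperHalfPlane) (i : DQ m) :
    jq hm (γ • τ) i = jq hm τ (DQ.perm γ i) := by
  induction i using Quotient.inductionOn with
  | h A =>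
    change jfun (DMat.gl hm A • (γ • τ)) = jfun (DMat.gl hm (DMat.rmul γ A) • τ)
    rw [DMat.gl_rmul, mul_smul]
    rfl

lemma DQ.finite {m : ℤ} (hm : m ≠ 0) : Finite (DQ m) := by
  have : Function.Surjective (fun A : FixedDetMatrices.reps m => (Quotient.mk'' A.1 : DQ m)) := by
    intro i
    induction i using Quotient.inductionOn with
    | h A =>
      obtain ⟨B, hB, γ, rfl⟩ := A.exists_rep hm
      refine ⟨⟨B, hB⟩, ?_⟩
      have h : (Quotient.mk'' (γ • B) : DQ m) = Quotient.mk'' B :=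
        Quotient.sound' (show MulAction.orbitRel SL(2, ℤ) (DMat m) (γ • B) B from ⟨γ, rfl⟩)
      exact h.symm
  exact Finite.of_surjective _ this

lemma exists_unit_exp (b : ℤ) {d : ℕ} (hd : 0 < d) :
    ∃ ζ : SIntˣ, ((ζ : SInt) : ℂ) = Complex.exp (2 * Real.pi * Complex.I * b / d) ∧
      ‖((ζ : SInt) : ℂ)‖ = 1 := by
  have hd' : (d : ℂ) ≠ 0 := by exact_mod_cast hd.ne'
  have h : ∀ b : ℤ, IsIntegral ℤ (Complex.exp (2 * Real.pi * Complex.I * b / d)) := by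
    intro b
    refine IsIntegral.of_pow hd ?_
    rw [← Complex.exp_nat_mul]
    have : (d : ℂ) * (2 * Real.pi * Complex.I * b / d) = b * (2 * Real.pi * Complex.I) := by
      field_simp
    rw [this, Complex.exp_int_mul_two_pi_mul_I]
    exact isIntegral_one
  refine ⟨⟨⟨_, h b⟩, ⟨_, h (-b)⟩, ?_, ?_⟩, rfl, ?_⟩
  · apply Subtype.ext
    change Complex.exp _ * Complex.exp _ = 1
    rw [← Complex.exp_add]
    push_cast
    rw [← Complex.exp_zero]
    congr 1
    ring
  · apply Subtype.ext
    change Complex.exp _ * Complex.exp _ = 1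
    rw [← Complex.exp_add]
    push_cast
    rw [← Complex.exp_zero]
    congr 1
    ring
  · change ‖Complex.exp (2 * Real.pi * Complex.I * b / d)‖ = 1
    have : 2 * Real.pi * Complex.I * b / d = ((2 * Real.pi * b / d : ℝ) : ℂ) * Complex.I := by
      push_cast; ring
    rw [this, Complex.norm_exp_ofReal_mul_I]

lemma jq_good {m : ℕ} (hm : (m : ℤ) ≠ 0) (hsq : ∀ s : ℕ, s ^ 2 ≠ m) (i : DQ m) :
    ∃ (k : ℕ) (c : SInt), IsUnit c ∧ Good m k c (fun τ => jfun τ - jq hm τ i) := by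
  have hm0 : 0 < m := by omega
  induction i using Quotient.inductionOn with
  | h A =>
  obtain ⟨B, ⟨h10, h00, h01, h11⟩, γ, rfl⟩ := A.exists_rep hm
  have hj : ∀ τ, jq hm τ (Quotient.mk _ (γ • B)) = jfun (DMat.gl hm B • τ) := by
    intro τ
    change jfun (DMat.gl hm (γ • B) • τ) = _
    rw [DMat.gl_smul, mul_smul]
    exact jfun_SL γ _
  simp_rw [hj]
  obtain ⟨a, ha⟩ : ∃ a : ℕ, B.1 0 0 = a := ⟨(B.1 0 0).toNat, by omega⟩
  have hdet : B.1 0 0 * B.1 1 1 = m := by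
    have := B.2
    rw [Matrix.det_fin_two, h10] at this
    linarith
  have hd0 : 0 < B.1 1 1 := by
    have h5 : (0 : ℤ) < B.1 0 0 * B.1 1 1 := by rw [hdet]; exact_mod_cast hm0
    exact (pos_iff_pos_of_mul_pos h5).mp h00
  obtain ⟨d, hd⟩ : ∃ d : ℕ, B.1 1 1 = d := ⟨(B.1 1 1).toNat, by omega⟩
  have ha0 : 0 < a := by omega
  have hd1 : 0 < d := by omega
  have had : a * d = m := by
    rw [ha, hd] at hdet
    exact_mod_cast hdet
  obtain ⟨ζ, hζ, hζ1⟩ := exists_unit_exp (B.1 0 1) hd1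
  have hq : ∀ τ, qN 1 (DMat.gl hm B • τ) = (ζ : SInt) * qN m τ ^ (a ^ 2) := by
    intro τ
    rw [hζ, qN, qN, ← Complex.exp_nat_mul, ← Complex.exp_add]
    congr 1
    have hpos : 0 < (DMat.gl hm B).det.val := by
      have h := RingHom.map_det (Int.castRingHom ℝ) B.1
      rw [B.2] at h
      have h2 : (B.1.map (Int.castRingHom ℝ)).det = (m : ℝ) := by
        have h3 := h.symm
        simpa using h3
      change 0 < (B.1.map (Int.castRingHom ℝ)).det
      rw [h2]
      exact_mod_cast hm0
    rw [coe_smul_of_det_pos hpos]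
    have hnum : num (DMat.gl hm B) τ = (a : ℂ) * τ + (B.1 0 1 : ℂ) := by
      change (((B.1 0 0 : ℤ) : ℝ) : ℂ) * τ + (((B.1 0 1 : ℤ) : ℝ) : ℂ) = _
      rw [ha]
      simp
    have hden : denom (DMat.gl hm B) τ = (d : ℂ) := by
      change (((B.1 1 0 : ℤ) : ℝ) : ℂ) * τ + (((B.1 1 1 : ℤ) : ℝ) : ℂ) = _
      rw [h10, hd]
      simp
    have hmc : (m : ℂ) = a * d := by exact_mod_cast had.symm
    rw [hnum, hden, hmc]
    have : (a : ℂ) ≠ 0 := by exact_mod_cast ha0.ne'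
    have : (d : ℂ) ≠ 0 := by exact_mod_cast hd1.ne'
    push_cast
    field_simp
    ring
  have hg := jfun_good.comp (M := m) (fun τ => DMat.gl hm B • τ) ζ hζ1 (a ^ 2) (by positivity) hq
  have hg2 := jfun_good.lift one_pos hm0
  rw [one_mul, one_mul] at hg2
  rw [one_mul] at hg
  rcases lt_or_gt_of_ne (hsq a) with h | h
  · exact ⟨m, 1, isUnit_one, hg2.sub_of_lt hg (by exact_mod_cast h)⟩
  · refine ⟨a ^ 2, -(1 * ((ζ ^ (-1 : ℤ) : SIntˣ) : SInt)), ?_, ?_⟩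
    · rw [one_mul]
      exact (Units.isUnit _).neg
    · have := (hg.sub_of_lt hg2 (by exact_mod_cast h)).neg
      rw [neg_sub] at this
      exact this

lemma jfun_integral_of_fixed {m : ℕ} (hm : (m : ℤ) ≠ 0) (hsq : ∀ s : ℕ, s ^ 2 ≠ m) (A : DMat m)
    {τ : UpperHalfPlane} (hA : DMat.gl hm A • τ = τ) : IsIntegral ℤ (jfun τ) := by
  have : Finite (DQ m) := DQ.finite hm
  have : Fintype (DQ m) := Fintype.ofFinite _
  choose k c hc hg using jq_good hm hsq
  have h1 := Good.prod Finset.univ (fun i _ => hg i)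
  have hi : InvST (∏ i, fun τ => jfun τ - jq hm τ i) := by
    constructor
    · intro τ
      simp only [Finset.prod_apply, jq_perm, jfun_SL]
      exact Equiv.prod_comp (DQ.perm S) (fun i => jfun τ - jq hm τ i)
    · intro τ
      simp only [Finset.prod_apply, jq_perm, jfun_SL]
      exact Equiv.prod_comp (DQ.perm T) (fun i => jfun τ - jq hm τ i)
  have hcu : IsUnit (∏ i, c i) := by
    rw [IsUnit.prod_univ_iff]
    exact hc
  obtain ⟨p, hp, -, hp2⟩ := qexp_principle jfun_good jfun_inv (N := m) (by omega) (∑ i, k i) _ _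
    (by push_cast; exact h1) hi
  have hlead := (hp2 hcu.ne_zero).2
  have h0 := hp τ
  rw [Finset.prod_apply, Finset.prod_eq_zero (Finset.mem_univ (Quotient.mk _ A : DQ m))] at h0
  · obtain ⟨u, hu⟩ := hcu.exists_left_inv
    have hInt : IsIntegral SInt (jfun τ) := by
      refine ⟨Polynomial.C u * p, ?_, ?_⟩
      · refine Polynomial.monic_C_mul_of_mul_leadingCoeff_eq_one ?_
        rw [hlead, hu]
      · rw [Polynomial.eval₂_mul, ← Polynomial.aeval_def, ← Polynomial.aeval_def, ← h0, mul_zero]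
    exact isIntegral_trans (A := SInt) _ hInt
  · change jfun τ - jfun (DMat.gl hm A • τ) = 0
    rw [hA, sub_self]


lemma jfun_integral {τ : UpperHalfPlane} (h : ∃ a b c : ℤ, a ≠ 0 ∧
    (a : ℂ) * (τ : ℂ) ^ 2 + b * (τ : ℂ) + c = 0) : IsIntegral ℤ (jfun τ) := by
  obtain ⟨a, b, c, ha, h⟩ := h
  have hD : b ^ 2 - 4 * a * c < 0 := by
    have hre := congrArg Complex.re h
    have him := congrArg Complex.im h
    simp [pow_two] at hre him
    have hi : (τ : UpperHalfPlane).im ≠ 0 := τ.im_pos.ne'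
    have h1 : (2 * a * τ.re + b : ℝ) = 0 := by
      apply mul_right_cancel₀ hi
      linarith
    have ha' : (a : ℝ) ≠ 0 := by exact_mod_cast ha
    have h2 : ((b ^ 2 - 4 * a * c : ℤ) : ℝ) = - (2 * a * τ.im) ^ 2 := by
      push_cast
      linear_combination (-4 * a : ℝ) * hre + (2 * a * τ.re + b) * h1
    have h3 : ((b ^ 2 - 4 * a * c : ℤ) : ℝ) < 0 := by
      rw [h2]
      have : 2 * (a : ℝ) * τ.im ≠ 0 := by positivity
      have := pow_pos (abs_pos.mpr this) 2
      rw [sq_abs] at this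
      linarith
    exact_mod_cast h3
  obtain ⟨E, hE⟩ : ∃ E, E = -(b ^ 2 - 4 * a * c) := ⟨_, rfl⟩
  obtain ⟨x, hx⟩ : ∃ x, x = |b| + E + 1 := ⟨_, rfl⟩
  have hb1 := le_abs_self b
  have hb2 := neg_abs_le b
  have h4 : 4 * (x ^ 2 - b * x + a * c) = (2 * x - b) ^ 2 + E := by rw [hE]; ring
  have hmpos : 0 < x ^ 2 - b * x + a * c := by nlinarith [sq_nonneg (2 * x - b)]
  obtain ⟨m, hm⟩ : ∃ m : ℕ, x ^ 2 - b * x + a * c = m := ⟨_, (Int.toNat_of_nonneg hmpos.le).symm⟩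
  have hm0 : (m : ℤ) ≠ 0 := by omega
  have hsq : ∀ s : ℕ, s ^ 2 ≠ m := by
    intro s hs
    have hs' : (2 * (s : ℤ)) ^ 2 = (2 * x - b) ^ 2 + E := by
      rw [← h4, hm, ← hs]; push_cast; ring
    have hp : 0 < 2 * x - b := by linarith
    have h5 : 2 * x - b < 2 * s := by
      apply lt_of_pow_lt_pow_left₀ 2 (by positivity)
      rw [hs']; linarith
    have h6 : 2 * (s : ℤ) < 2 * x - b + 1 := by
      apply lt_of_pow_lt_pow_left₀ 2 (by linarith)
      rw [hs']; nlinarith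
    omega
  refine jfun_integral_of_fixed hm0 hsq ⟨!![x - b, -c; a, x], ?_⟩ ?_
  · rw [← hm, Matrix.det_fin_two_of]; ring
  · apply UpperHalfPlane.ext
    have hpos : 0 < (DMat.gl hm0 ⟨!![x - b, -c; a, x], by
        rw [← hm, Matrix.det_fin_two_of]; ring⟩).det.val := by
      change 0 < (Matrix.map !![x - b, -c; a, x] (Int.castRingHom ℝ)).det
      have h := RingHom.map_det (Int.castRingHom ℝ) !![x - b, -c; a, x]
      have h2 : (Matrix.map !![x - b, -c; a, x] (Int.castRingHom ℝ)).det = (m : ℝ) := by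
        refine h.symm.trans ?_
        have : (!![x - b, -c; a, x]).det = m := by rw [← hm, Matrix.det_fin_two_of]; ring
        rw [this]; simp
      rw [h2]
      have : 0 < m := by omega
      exact_mod_cast this
    rw [coe_smul_of_det_pos hpos]
    rw [div_eq_iff (denom_ne_zero _ _)]
    change ((((x - b : ℤ)) : ℝ) : ℂ) * τ + (((-c : ℤ) : ℝ) : ℂ) =
      τ * ((((a : ℤ)) : ℝ) * τ + (((x : ℤ) : ℝ) : ℂ))
    push_cast
    linear_combination -h

end Part5

section Part6
open Complex UpperHalfPlane Filter Topology

section JTP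

/-- finite Euler product -/
noncomputable def fP (x : ℂ) (m : ℕ) : ℂ := ∏ k ∈ Finset.range m, (1 - x ^ (k + 1))

/-- reciprocal of the finite Euler product, extended by zero to negative integers -/
noncomputable def rP (x : ℂ) (m : ℤ) : ℂ := if 0 ≤ m then (fP x m.toNat)⁻¹ else 0

lemma one_sub_pow_ne {x : ℂ} (hx : ‖x‖ < 1) (k : ℕ) : 1 - x ^ (k + 1) ≠ 0 := by
  intro h
  have h1 : x ^ (k + 1) = 1 := (sub_eq_zero.mp h).symm
  have h2 : ‖x‖ ^ (k + 1) = 1 := by rw [← norm_pow, h1, norm_one]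
  have := pow_lt_one₀ (norm_nonneg x) hx (Nat.succ_ne_zero k)
  exact absurd h2 this.ne

lemma fP_ne {x : ℂ} (hx : ‖x‖ < 1) (m : ℕ) : fP x m ≠ 0 :=
  Finset.prod_ne_zero_iff.mpr fun k _ => one_sub_pow_ne hx k

lemma rP_rec {x : ℂ} (hx : ‖x‖ < 1) (m : ℤ) : rP x (m - 1) = rP x m * (1 - x ^ m) := by
  rcases lt_trichotomy m 0 with h | h | h
  · rw [rP, rP, if_neg (by omega), if_neg (by omega), zero_mul]
  · subst h
    rw [rP, if_neg (by omega)]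
    simp
  · obtain ⟨k, rfl⟩ : ∃ k : ℕ, m = k + 1 := ⟨(m - 1).toNat, by omega⟩
    rw [rP, rP, if_pos (by omega), if_pos (by omega)]
    have h1 : ((k : ℤ) + 1 - 1).toNat = k := by omega
    have h2 : ((k : ℤ) + 1).toNat = k + 1 := by omega
    rw [h1, h2, fP, fP, Finset.prod_range_succ]
    have h3 := one_sub_pow_ne hx k
    have h4 := fP_ne hx k
    rw [fP] at h4
    have h5 : x ^ ((k : ℤ) + 1) = x ^ (k + 1) := by exact_mod_cast rfl
    rw [h5]
    field_simp

/-- coefficients of the finite triple product -/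
noncomputable def cJ (q : ℂ) (N : ℕ) (n : ℤ) : ℂ :=
  q ^ (n ^ 2) * fP (q ^ 2) (2 * N) * rP (q ^ 2) (N - n) * rP (q ^ 2) (N + n)

lemma cJ_rec {q : ℂ} (hq0 : q ≠ 0) (hq : ‖q‖ < 1) (N : ℕ) (n : ℤ) :
    cJ q (N + 1) n = (1 + q ^ (4 * N + 2)) * cJ q N n +
      q ^ (2 * N + 1) * (cJ q N (n - 1) + cJ q N (n + 1)) := by
  have hx : ‖q ^ 2‖ < 1 := by
    rw [norm_pow]; exact pow_lt_one₀ (norm_nonneg q) hq two_ne_zero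
  obtain ⟨A, hA⟩ : ∃ A, A = q ^ (2 * N) := ⟨_, rfl⟩
  obtain ⟨B, hB⟩ : ∃ B, B = q ^ (2 * n) := ⟨_, rfl⟩
  have hB0 : B ≠ 0 := by rw [hB]; exact zpow_ne_zero _ hq0
  have hAz : A = q ^ (2 * (N : ℤ)) := by rw [hA]; exact_mod_cast rfl
  have e1 : (q ^ 2) ^ ((N : ℤ) + 1 - n) = A * q ^ 2 / B := by
    rw [hAz, hB, ← zpow_natCast q 2, ← zpow_mul, ← zpow_add₀ hq0, ← zpow_sub₀ hq0]
    congr 1; push_cast; ring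
  have e2 : (q ^ 2) ^ ((N : ℤ) + 1 + n) = A * q ^ 2 * B := by
    rw [hAz, hB, ← zpow_natCast q 2, ← zpow_mul, ← zpow_add₀ hq0, ← zpow_add₀ hq0]
    congr 1; push_cast; ring
  have e3 : (q ^ 2) ^ ((N : ℤ) - n) = A / B := by
    rw [hAz, hB, ← zpow_natCast q 2, ← zpow_mul, ← zpow_sub₀ hq0]
    congr 1; push_cast; ring
  have e4 : (q ^ 2) ^ ((N : ℤ) + n) = A * B := by
    rw [hAz, hB, ← zpow_natCast q 2, ← zpow_mul, ← zpow_add₀ hq0]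
    congr 1; push_cast; ring
  have r1 := rP_rec hx (N + 1 - n)
  have r2 := rP_rec hx (N + 1 + n)
  have r3 := rP_rec hx (N - n)
  have r4 := rP_rec hx (N + n)
  rw [e1, show (N : ℤ) + 1 - n - 1 = N - n by ring] at r1
  rw [e2, show (N : ℤ) + 1 + n - 1 = N + n by ring] at r2
  rw [e3, r1] at r3
  rw [e4, r2] at r4
  have p1 : fP (q ^ 2) (2 * (N + 1)) =
      fP (q ^ 2) (2 * N) * (1 - A ^ 2 * q ^ 2) * (1 - A ^ 2 * q ^ 4) := by
    rw [show 2 * (N + 1) = 2 * N + 1 + 1 by ring, fP, Finset.prod_range_succ,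
      Finset.prod_range_succ, fP, hA]
    ring
  have s1 : q ^ ((n - 1) ^ 2) = q ^ (n ^ 2) * q / B := by
    rw [hB, ← zpow_add_one₀ hq0, ← zpow_sub₀ hq0]
    congr 1; ring
  have s2 : q ^ ((n + 1) ^ 2) = q ^ (n ^ 2) * q * B := by
    rw [hB, ← zpow_add_one₀ hq0, ← zpow_add₀ hq0]
    congr 1; ring
  have a1 : q ^ (4 * N + 2) = A ^ 2 * q ^ 2 := by rw [hA]; ring
  have a2 : q ^ (2 * N + 1) = A * q := by rw [hA]; ring
  rw [cJ, cJ, cJ, cJ, p1, s1, s2, a1, a2]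
  push_cast
  rw [show (N : ℤ) - (n - 1) = N + 1 - n by ring, show (N : ℤ) + (n - 1) = N + n - 1 by ring,
    show (N : ℤ) - (n + 1) = N - n - 1 by ring, show (N : ℤ) + (n + 1) = N + 1 + n by ring,
    r3, r4, r1, r2]
  field_simp
  ring

/-- finite triple product -/
noncomputable def fJ (q w : ℂ) (N : ℕ) : ℂ :=
  (∏ k ∈ Finset.range N, (1 + q ^ (2 * k + 1) * w)) *
    ∏ k ∈ Finset.range N, (1 + q ^ (2 * k + 1) * w⁻¹)

lemma fJ_hasSum {q w : ℂ} (hq0 : q ≠ 0) (hq : ‖q‖ < 1) (hw : w ≠ 0) (N : ℕ) :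
    HasSum (fun n : ℤ => cJ q N n * w ^ n) (fJ q w N) := by
  induction N with
  | zero =>
    have : fJ q w 0 = cJ q 0 0 * w ^ (0 : ℤ) := by simp [fJ, cJ, rP, fP]
    rw [this]
    apply hasSum_single
    intro n hn
    have : rP (q ^ 2) (-n) * rP (q ^ 2) n = 0 := by
      rcases lt_or_gt_of_ne hn with h | h
      · rw [rP, rP, if_neg (show ¬ 0 ≤ n by omega), mul_zero]
      · rw [rP, if_neg (show ¬ 0 ≤ -n by omega), zero_mul]
    simp only [cJ, Nat.cast_zero, zero_sub, zero_add]
    linear_combination (q ^ n ^ 2 * fP (q ^ 2) (2 * 0) * w ^ n) * this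
  | succ N ih =>
    have h1 := ih.mul_left (1 + q ^ (4 * N + 2))
    have h2 := (((Equiv.subRight (1 : ℤ)).hasSum_iff.mpr ih).mul_left w).mul_left (q ^ (2 * N + 1))
    have h3 := (((Equiv.addRight (1 : ℤ)).hasSum_iff.mpr ih).mul_left w⁻¹).mul_left
      (q ^ (2 * N + 1))
    have h := (h1.add h2).add h3
    have e : fJ q w (N + 1) = (1 + q ^ (4 * N + 2)) * fJ q w N + q ^ (2 * N + 1) * (w * fJ q w N)
        + q ^ (2 * N + 1) * (w⁻¹ * fJ q w N) := by
      rw [fJ, fJ, Finset.prod_range_succ, Finset.prod_range_succ]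
      linear_combination ((∏ k ∈ Finset.range N, (1 + q ^ (2 * k + 1) * w)) *
        (∏ k ∈ Finset.range N, (1 + q ^ (2 * k + 1) * w⁻¹)) * q ^ (4 * N + 2)) *
          mul_inv_cancel₀ hw
    rw [e]
    refine (congrArg (fun f => HasSum f _) (funext fun n => ?_)).mpr h
    change cJ q (N + 1) n * w ^ n = (1 + q ^ (4 * N + 2)) * (cJ q N n * w ^ n) +
      q ^ (2 * N + 1) * (w * (cJ q N (n - 1) * w ^ (n - 1))) +
      q ^ (2 * N + 1) * (w⁻¹ * (cJ q N (n + 1) * w ^ (n + 1)))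
    rw [cJ_rec hq0 hq, zpow_sub_one₀ hw, zpow_add_one₀ hw]
    field_simp
    ring

lemma summable_aux {q : ℂ} (hq : ‖q‖ < 1) (w : ℂ) :
    Summable fun k : ℕ => ‖q ^ (2 * k + 1) * w‖ := by
  have h : ‖q ^ 2‖ < 1 := by
    rw [norm_pow]; exact pow_lt_one₀ (norm_nonneg q) hq two_ne_zero
  have := (summable_geometric_of_lt_one (norm_nonneg _) h).mul_left (‖q‖ * ‖w‖)
  refine this.congr fun k => ?_
  simp only [norm_mul, norm_pow]
  ring

lemma fP_tendsto {x : ℂ} (hx : ‖x‖ < 1) :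
    Tendsto (fP x) atTop (𝓝 (∏' n : ℕ, (1 - x ^ (n + 1)))) :=
  (ModularForm.multipliable_one_sub_pow hx).tendsto_prod_tprod_nat

lemma fP_lim_ne {x : ℂ} (hx : ‖x‖ < 1) : (∏' n : ℕ, (1 - x ^ (n + 1))) ≠ 0 := by
  simp_rw [sub_eq_add_neg]
  refine tprod_one_add_ne_zero_of_summable (f := fun n : ℕ => -x ^ (n + 1)) ?_ ?_
  · intro n
    rw [← sub_eq_add_neg]
    exact one_sub_pow_ne hx n
  · simpa using (summable_nat_add_iff 1).mpr (summable_geometric_of_lt_one (norm_nonneg _) hx)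

lemma rP_tendsto {x : ℂ} (hx : ‖x‖ < 1) :
    Tendsto (rP x) atTop (𝓝 (∏' n : ℕ, (1 - x ^ (n + 1)))⁻¹) := by
  have h : Tendsto (fun m : ℤ => (fP x m.toNat)⁻¹) atTop (𝓝 (∏' n : ℕ, (1 - x ^ (n + 1)))⁻¹) := by
    refine ((fP_tendsto hx).comp ?_).inv₀ (fP_lim_ne hx)
    exact tendsto_atTop_mono (fun m => Int.self_le_toNat m) tendsto_id |> fun h =>
      tendsto_natCast_atTop_iff.mp h
  refine h.congr' ?_
  filter_upwards [eventually_ge_atTop 0] with m hm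
  rw [rP, if_pos hm]

lemma fP_bdd {x : ℂ} (hx : ‖x‖ < 1) : ∃ C : ℝ, ∀ m, ‖fP x m‖ ≤ C := by
  obtain ⟨C, hC⟩ := (Metric.isBounded_range_of_tendsto _ (fP_tendsto hx)).exists_norm_le
  exact ⟨C, fun m => hC _ ⟨m, rfl⟩⟩

lemma rP_bdd {x : ℂ} (hx : ‖x‖ < 1) : ∃ C : ℝ, ∀ m, ‖rP x m‖ ≤ C := by
  obtain ⟨C, hC⟩ := (Metric.isBounded_range_of_tendsto _
    ((fP_tendsto hx).inv₀ (fP_lim_ne hx))).exists_norm_le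
  refine ⟨C, fun m => ?_⟩
  rw [rP]
  split_ifs
  · exact hC _ ⟨m.toNat, rfl⟩
  · rw [norm_zero]
    exact (norm_nonneg _).trans (hC _ ⟨0, rfl⟩)

/-- Jacobi triple product. -/
lemma jacobi_triple {q w : ℂ} (hq0 : q ≠ 0) (hq : ‖q‖ < 1) (hw : w ≠ 0)
    (hs : Summable fun n : ℤ => q ^ (n ^ 2) * w ^ n) :
    ∑' n : ℤ, q ^ (n ^ 2) * w ^ n = (∏' n : ℕ, (1 - (q ^ 2) ^ (n + 1))) *
      ((∏' k : ℕ, (1 + q ^ (2 * k + 1) * w)) * ∏' k : ℕ, (1 + q ^ (2 * k + 1) * w⁻¹)) := by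
  have hx : ‖q ^ 2‖ < 1 := by
    rw [norm_pow]; exact pow_lt_one₀ (norm_nonneg q) hq two_ne_zero
  obtain ⟨E, hE⟩ : ∃ E, E = ∏' n : ℕ, (1 - (q ^ 2) ^ (n + 1)) := ⟨_, rfl⟩
  have hE0 : E ≠ 0 := hE ▸ fP_lim_ne hx
  obtain ⟨C, hC⟩ := fP_bdd hx
  obtain ⟨D, hD⟩ := rP_bdd hx
  have hC0 : 0 ≤ C := (norm_nonneg _).trans (hC 0)
  have hD0 : 0 ≤ D := (norm_nonneg _).trans (hD 0)
  have h1 : Tendsto (fJ q w) atTop (𝓝 ((∏' k : ℕ, (1 + q ^ (2 * k + 1) * w)) *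
      ∏' k : ℕ, (1 + q ^ (2 * k + 1) * w⁻¹))) :=
    (multipliable_one_add_of_summable (summable_aux hq w)).tendsto_prod_tprod_nat.mul
      (multipliable_one_add_of_summable (summable_aux hq w⁻¹)).tendsto_prod_tprod_nat
  have h2 : Tendsto (fun N : ℕ => ∑' n : ℤ, cJ q N n * w ^ n) atTop
      (𝓝 (∑' n : ℤ, E⁻¹ * (q ^ (n ^ 2) * w ^ n))) := by
    refine tendsto_tsum_of_dominated_convergence
      (bound := fun n : ℤ => (C * D * D) * ‖q ^ (n ^ 2) * w ^ n‖) (hs.norm.mul_left _) ?_ ?_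
    · intro n
      have t1 : Tendsto (fun N : ℕ => fP (q ^ 2) (2 * N)) atTop (𝓝 E) := by
        rw [hE]
        exact (fP_tendsto hx).comp (tendsto_id.const_mul_atTop' two_pos)
      have t2 : Tendsto (fun N : ℕ => rP (q ^ 2) (N - n)) atTop (𝓝 E⁻¹) := by
        rw [hE]
        exact (rP_tendsto hx).comp
          (tendsto_atTop_add_const_right _ (-n) tendsto_natCast_atTop_atTop)
      have t3 : Tendsto (fun N : ℕ => rP (q ^ 2) (N + n)) atTop (𝓝 E⁻¹) := by
        rw [hE]
        exact (rP_tendsto hx).comp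
          (tendsto_atTop_add_const_right _ n tendsto_natCast_atTop_atTop)
      have t := (((t1.const_mul (q ^ (n ^ 2))).mul t2).mul t3).mul_const (w ^ n)
      convert t using 2
      · rfl
      · field_simp
    · refine Eventually.of_forall fun N n => ?_
      have : cJ q N n * w ^ n = (fP (q ^ 2) (2 * N) * rP (q ^ 2) (N - n) * rP (q ^ 2) (N + n)) *
        (q ^ (n ^ 2) * w ^ n) := by rw [cJ]; ring
      rw [this, norm_mul, norm_mul (_ * _), norm_mul (fP _ _)]
      gcongr
      · exact hC _
      · exact hD _
      · exact hD _
  have h3 : (fun N : ℕ => ∑' n : ℤ, cJ q N n * w ^ n) = fJ q w :=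
    funext fun N => (fJ_hasSum hq0 hq hw N).tsum_eq
  rw [h3] at h2
  have h4 := tendsto_nhds_unique h1 h2
  rw [tsum_mul_left] at h4
  rw [h4, ← hE]
  field_simp

lemma theta_product (z : ℂ) {τ : ℂ} (hτ : 0 < τ.im) {q w : ℂ}
    (hq : q = Complex.exp (Real.pi * Complex.I * τ))
    (hw : w = Complex.exp (2 * Real.pi * Complex.I * z)) :
    jacobiTheta₂ z τ = (∏' n : ℕ, (1 - (q ^ 2) ^ (n + 1))) *
      ((∏' k : ℕ, (1 + q ^ (2 * k + 1) * w)) * ∏' k : ℕ, (1 + q ^ (2 * k + 1) * w⁻¹)) := by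
  have hq0 : q ≠ 0 := hq ▸ Complex.exp_ne_zero _
  have hw0 : w ≠ 0 := hw ▸ Complex.exp_ne_zero _
  have hq1 : ‖q‖ < 1 := by
    rw [hq, Complex.norm_exp]
    simp
    positivity
  have ht : ∀ n : ℤ, jacobiTheta₂_term n z τ = q ^ (n ^ 2) * w ^ n := by
    intro n
    rw [jacobiTheta₂_term, hq, hw, ← Complex.exp_int_mul, ← Complex.exp_int_mul, ← Complex.exp_add]
    congr 1
    push_cast
    ring
  have hs := (summable_jacobiTheta₂_term_iff z τ).mpr hτ
  simp_rw [ht] at hs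
  rw [jacobiTheta₂]
  simp_rw [ht]
  exact jacobi_triple hq0 hq1 hw0 hs

end JTP

end Part6

section Part7
open Complex UpperHalfPlane ModularGroup MatrixGroups Filter Topology

section ThetaChar

/-- General term of the theta series with characteristics `w/10, y/10`. -/
noncomputable def thTerm (w y : ℤ) (τ : UpperHalfPlane) (n : ℤ) : ℂ :=
  Complex.exp (Real.pi * Complex.I * (n + w / 10) ^ 2 * τ +
    2 * Real.pi * Complex.I * (n + w / 10) * (y / 10))

/-- Theta function with characteristics `w/10, y/10`. -/
noncomputable def th (w y : ℤ) (τ : UpperHalfPlane) : ℂ :=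
  Complex.exp (Real.pi * Complex.I * (w / 10) ^ 2 * τ +
    2 * Real.pi * Complex.I * (w / 10) * (y / 10)) *
    jacobiTheta₂ (y / 10 + w / 10 * τ) τ

lemma th_hasSum (w y : ℤ) (τ : UpperHalfPlane) : HasSum (thTerm w y τ) (th w y τ) := by
  have h := (hasSum_jacobiTheta₂_term (y / 10 + w / 10 * τ) τ.im_pos).mul_left
    (Complex.exp (Real.pi * Complex.I * (w / 10) ^ 2 * τ +
    2 * Real.pi * Complex.I * (w / 10) * (y / 10)))
  refine (congrArg (fun f => HasSum f _) (funext fun n => ?_)).mpr h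
  rw [thTerm, jacobiTheta₂_term, ← Complex.exp_add]
  congr 1
  ring

lemma th_add_left (w y k : ℤ) (τ : UpperHalfPlane) : th (w + 10 * k) y τ = th w y τ := by
  refine (th_hasSum _ _ τ).unique ?_
  have h := (Equiv.addRight k).hasSum_iff.mpr (th_hasSum w y τ)
  refine (congrArg (fun f => HasSum f _) (funext fun n => ?_)).mpr h
  change _ = thTerm w y τ (n + k)
  rw [thTerm, thTerm]
  congr 1
  push_cast
  ring

lemma exp_int_eq_one (m : ℤ) {x : ℂ} (h : x = 2 * Real.pi * Complex.I * m) :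
    Complex.exp x = 1 := by
  rw [h, mul_comm, Complex.exp_int_mul_two_pi_mul_I]

lemma exp_eq_of_int (m : ℤ) {x y : ℂ} (h : x = y + 2 * Real.pi * Complex.I * m) :
    Complex.exp x = Complex.exp y := by
  rw [h, Complex.exp_add, exp_int_eq_one m rfl, mul_one]

lemma th_add_right (w y k : ℤ) (τ : UpperHalfPlane) : th w (y + 10 * k) τ =
    Complex.exp (2 * Real.pi * Complex.I * (w * k / 10)) * th w y τ := by
  refine (th_hasSum _ _ τ).unique ?_
  have h := (th_hasSum w y τ).mul_left (Complex.exp (2 * Real.pi * Complex.I * (w * k / 10)))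
  refine (congrArg (fun f => HasSum f _) (funext fun n => ?_)).mpr h
  rw [thTerm, thTerm, ← Complex.exp_add]
  apply exp_eq_of_int (n * k)
  push_cast
  ring

lemma th_T (w y : ℤ) (τ : UpperHalfPlane) : th w y (T • τ) =
    Complex.exp (-(Real.pi * Complex.I * (w / 10 + (w / 10) ^ 2))) * th w (y + w + 5) τ := by
  refine (th_hasSum _ _ _).unique ?_
  have h := (th_hasSum w (y + w + 5) τ).mul_left
    (Complex.exp (-(Real.pi * Complex.I * (w / 10 + (w / 10) ^ 2))))
  refine (congrArg (fun f => HasSum f _) (funext fun n => ?_)).mpr h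
  have eT : ((T • τ : UpperHalfPlane) : ℂ) = 1 + τ := by
    rw [UpperHalfPlane.modular_T_smul, UpperHalfPlane.coe_vadd]
    simp
  rw [thTerm, thTerm, ← Complex.exp_add, eT]
  obtain ⟨m, hm⟩ : ∃ m, n ^ 2 - n = m + m := by
    have := Int.even_mul_pred_self n
    obtain ⟨m, hm⟩ := this
    exact ⟨m, by linarith⟩
  have hm' : (n : ℂ) ^ 2 - n = m + m := by exact_mod_cast hm
  apply exp_eq_of_int m
  push_cast
  linear_combination (Real.pi * Complex.I) * hm'

lemma th_S (w y : ℤ) (τ : UpperHalfPlane) : th w y (S • τ) =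
    (-Complex.I * τ) ^ (1 / 2 : ℂ) * Complex.exp (2 * Real.pi * Complex.I * (w * y / 100)) *
      th y (-w) τ := by
  have h := jacobiTheta₂_functional_equation (y / 10 * τ - w / 10) τ
  have hτ : (τ : ℂ) ≠ 0 := τ.ne_zero
  have e1 : (y / 10 * (τ : ℂ) - w / 10) / τ = y / 10 + w / 10 * (-1 / τ) := by
    field_simp
    ring
  have e2 : ((S • τ : UpperHalfPlane) : ℂ) = -1 / τ := by
    rw [UpperHalfPlane.modular_S_smul]
    change (-(τ : ℂ))⁻¹ = _
    field_simp
  rw [e1] at h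
  have h0 : (-Complex.I * (τ : ℂ)) ^ (1 / 2 : ℂ) ≠ 0 := by
    rw [Complex.cpow_ne_zero_iff]
    left
    exact mul_ne_zero (neg_ne_zero.mpr Complex.I_ne_zero) hτ
  rw [th, th, e2]
  have e3 : ((y / 10 * (τ : ℂ) - w / 10)) = ((-w : ℤ) : ℂ) / 10 + y / 10 * τ := by
    push_cast; ring
  rw [← e3, h]
  have e4 : (-Complex.I * (τ : ℂ)) ^ (1 / 2 : ℂ) *
      Complex.exp (2 * Real.pi * Complex.I * (w * y / 100)) *
      (Complex.exp (Real.pi * Complex.I * (y / 10) ^ 2 * τ +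
        2 * Real.pi * Complex.I * (y / 10) * (((-w : ℤ) : ℂ) / 10)) *
        (1 / (-Complex.I * (τ : ℂ)) ^ (1 / 2 : ℂ) *
        Complex.exp (-Real.pi * Complex.I * (y / 10 * τ - w / 10) ^ 2 / τ) *
          jacobiTheta₂ (y / 10 + w / 10 * (-1 / τ)) (-1 / τ))) =
      Complex.exp (2 * Real.pi * Complex.I * (w * y / 100)) *
      (Complex.exp (Real.pi * Complex.I * (y / 10) ^ 2 * τ +
        2 * Real.pi * Complex.I * (y / 10) * (((-w : ℤ) : ℂ) / 10)) *
        Complex.exp (-Real.pi * Complex.I * (y / 10 * τ - w / 10) ^ 2 / τ)) *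
          jacobiTheta₂ (y / 10 + w / 10 * (-1 / τ)) (-1 / τ) := by
    field_simp
  rw [e4, ← Complex.exp_add, ← Complex.exp_add]
  congr 2
  push_cast
  field_simp
  ring

/-- Powers of theta functions, indexed by residues. -/
noncomputable def thP (p : ZMod 10 × ZMod 10) (τ : UpperHalfPlane) : ℂ :=
  th p.1.valMinAbs p.2.valMinAbs τ ^ 200

lemma thP_cast (w y : ℤ) (τ : UpperHalfPlane) :
    thP ((w : ZMod 10), (y : ZMod 10)) τ = th w y τ ^ 200 := by
  have key : ∀ w : ℤ, ∃ k, (w : ZMod 10).valMinAbs = w + 10 * k := by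
    intro w
    have h : (((w : ZMod 10).valMinAbs : ℤ) : ZMod 10) = (w : ZMod 10) := ZMod.coe_valMinAbs _
    rw [ZMod.intCast_eq_intCast_iff_dvd_sub] at h
    obtain ⟨k, hk⟩ := h
    exact ⟨-k, by push_cast at hk; linarith⟩
  obtain ⟨k, hk⟩ := key w
  obtain ⟨l, hl⟩ := key y
  rw [thP]
  simp only
  rw [hk, hl, th_add_left, th_add_right, mul_pow, ← Complex.exp_nat_mul,
    exp_int_eq_one (20 * w * l) (by push_cast; ring), one_mul]

lemma thP_T (p : ZMod 10 × ZMod 10) (τ : UpperHalfPlane) :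
    thP p (T • τ) = thP (p.1, p.2 + p.1 + 5) τ := by
  obtain ⟨w, hw⟩ := ZMod.intCast_surjective p.1
  obtain ⟨y, hy⟩ := ZMod.intCast_surjective p.2
  have h1 : p = ((w : ZMod 10), (y : ZMod 10)) := by rw [hw, hy]
  have h2 : (p.1, p.2 + p.1 + 5) = ((w : ZMod 10), ((y + w + 5 : ℤ) : ZMod 10)) := by
    rw [← hw, ← hy]; push_cast; rfl
  rw [h2, h1, thP_cast, thP_cast, th_T, mul_pow, ← Complex.exp_nat_mul,
    exp_int_eq_one (-(10 * w + w ^ 2)) (by push_cast; ring), one_mul]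

lemma thP_S (p : ZMod 10 × ZMod 10) (τ : UpperHalfPlane) :
    thP p (S • τ) = ((-Complex.I * τ) ^ (1 / 2 : ℂ)) ^ 200 * thP (p.2, -p.1) τ := by
  obtain ⟨w, hw⟩ := ZMod.intCast_surjective p.1
  obtain ⟨y, hy⟩ := ZMod.intCast_surjective p.2
  have h1 : p = ((w : ZMod 10), (y : ZMod 10)) := by rw [hw, hy]
  have h2 : (p.2, -p.1) = ((y : ZMod 10), ((-w : ℤ) : ZMod 10)) := by
    rw [← hw, ← hy]; push_cast; rfl
  rw [h2, h1, thP_cast, thP_cast, th_S, mul_pow, mul_pow, ← Complex.exp_nat_mul,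
    exp_int_eq_one (2 * w * y) (by push_cast; ring), mul_one]

lemma th_good_aux (w y : ℤ) (hw1 : -5 < w) (hw2 : w ≤ 5) (a : ℤ → SInt)
    (ha : ∀ n : ℤ, (a n : ℂ) =
      Complex.exp (2 * Real.pi * Complex.I * (((10 * n + w) * y : ℤ) : ℂ) / (100 : ℕ)))
    (F : Finset ℤ) (hF : ∀ n : ℤ, n ∈ F ↔ 20 * n * (5 * n + w) = 0) :
    Good 200 (-w ^ 2) (∑ n ∈ F, a n) (th w y) := by
  have hnn : ∀ n : ℤ, 0 ≤ 20 * n * (5 * n + w) := by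
    intro n
    rcases lt_trichotomy n 0 with h | h | h
    · nlinarith
    · simp [h]
    · nlinarith
  have he : ∀ m : ℕ, ((fun n : ℤ => (20 * n * (5 * n + w)).toNat) ⁻¹' {m}).Finite := by
    intro m
    refine (Set.finite_Icc (-(m : ℤ) - 1) (m + 1)).subset ?_
    intro n hn
    have hn' : (20 * n * (5 * n + w)).toNat = m := hn
    have h1 : 20 * n * (5 * n + w) = m := by have := hnn n; omega
    constructor
    · by_contra hc
      push Not at hc
      nlinarith
    · by_contra hc
      push Not at hc
      nlinarith
  have hF' : F = (he 0).toFinset := by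
    ext n
    rw [hF, Set.Finite.mem_toFinset]
    have := hnn n
    change _ ↔ (20 * n * (5 * n + w)).toNat = 0
    omega
  rw [hF']
  refine Good.of_hasSum (by norm_num) _ _ he a fun τ => ?_
  have h := (th_hasSum w y τ).mul_right (qN 200 τ ^ (-w ^ 2))
  refine (congrArg (fun f => HasSum f _) (funext fun n => ?_)).mpr h
  have hz : qN 200 τ ^ (20 * n * (5 * n + w)).toNat = qN 200 τ ^ (20 * n * (5 * n + w)) := by
    rw [← zpow_natCast, Int.toNat_of_nonneg (hnn n)]
  rw [hz, ha, thTerm, qN, ← Complex.exp_int_mul, ← Complex.exp_int_mul, ← Complex.exp_add,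
    ← Complex.exp_add]
  congr 1
  push_cast
  ring

lemma th_ne_zero (w y : ℤ) (hw1 : -5 < w) (hw2 : w ≤ 5)
    (h5 : w = 5 → Complex.exp (-(2 * Real.pi * Complex.I * (y / 10))) ≠ -1) (τ : UpperHalfPlane) :
    th w y τ ≠ 0 := by
  rw [th]
  refine mul_ne_zero (Complex.exp_ne_zero _) ?_
  rw [theta_product _ τ.im_pos rfl rfl]
  obtain ⟨q, hq⟩ : ∃ q, q = Complex.exp (Real.pi * Complex.I * τ) := ⟨_, rfl⟩
  rw [← hq]
  have hq1 : ‖q‖ < 1 := by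
    rw [hq, Complex.norm_exp]
    simp
    positivity
  have hx : ‖q ^ 2‖ < 1 := by
    rw [norm_pow]; exact pow_lt_one₀ (norm_nonneg q) hq1 two_ne_zero
  have hlt : ∀ (k : ℕ) (c : ℤ), -10 * (2 * k + 1 : ℤ) < 2 * c → ∀ z : ℂ, z.im = c / 10 * τ.im →
      1 + q ^ (2 * k + 1) * Complex.exp (2 * Real.pi * Complex.I * z) ≠ 0 := by
    intro k c hc z hz h
    have h1 : q ^ (2 * k + 1) * Complex.exp (2 * Real.pi * Complex.I * z) = -1 := by
      linear_combination h
    have h2 := congrArg norm h1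
    rw [hq, ← Complex.exp_nat_mul, ← Complex.exp_add, Complex.norm_exp, norm_neg, norm_one,
      Real.exp_eq_one_iff] at h2
    have h3 : (((2 * k + 1 : ℕ) : ℂ) * (Real.pi * Complex.I * τ) + 2 * Real.pi * Complex.I * z).re =
        -(Real.pi * τ.im * ((2 * k + 1) + 2 * c / 10)) := by
      simp [hz]
      ring
    rw [h3] at h2
    have h4 : (0 : ℝ) < (2 * k + 1) + 2 * c / 10 := by
      have : (-10 * (2 * k + 1) : ℝ) < 2 * c := by exact_mod_cast hc
      linarith
    have := mul_pos (mul_pos Real.pi_pos τ.im_pos) h4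
    linarith
  have hinv : (Complex.exp (2 * Real.pi * Complex.I * (y / 10 + w / 10 * τ)))⁻¹ =
      Complex.exp (2 * Real.pi * Complex.I * (-(y / 10 + w / 10 * τ))) := by
    rw [← Complex.exp_neg]; congr 1; ring
  refine mul_ne_zero (fP_lim_ne hx) (mul_ne_zero ?_ ?_)
  · refine tprod_one_add_ne_zero_of_summable (fun k => ?_) (summable_aux hq1 _)
    refine hlt k w (by omega) _ ?_
    simp
  · refine tprod_one_add_ne_zero_of_summable (fun k => ?_) (summable_aux hq1 _)
    rw [hinv]
    by_cases hk : k = 0 ∧ w = 5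
    · obtain ⟨rfl, hw⟩ := hk
      intro h
      apply h5 hw
      rw [hq, ← Complex.exp_nat_mul, ← Complex.exp_add] at h
      rw [← sub_eq_zero, sub_neg_eq_add, add_comm, ← h, hw]
      congr 2
      push_cast
      ring
    · refine hlt k (-w) (by omega) _ ?_
      simp
      ring

/-- Admissible denominators. -/
def Adm (p : ZMod 10 × ZMod 10) : Prop :=
  ¬(5 * p.1 = 5 ∧ 5 * p.2 = 5) ∧ ¬(2 * p.1 = 0 ∧ 2 * p.2 = 0)

instance : DecidablePred Adm := fun p => by unfold Adm; infer_instance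

lemma thP_mem (p : ZMod 10 × ZMod 10) : thP p ∈ goodRing 200 := by
  choose a ha ha1 using fun n : ℤ => exists_unit_exp ((10 * n + p.1.valMinAbs) * p.2.valMinAbs)
    (d := 100) (by norm_num)
  have hm := ZMod.valMinAbs_mem_Ioc p.1
  have h1 : -5 < p.1.valMinAbs := by have := hm.1; push_cast at this; omega
  have h2 : p.1.valMinAbs ≤ 5 := by have := hm.2; push_cast at this; omega
  by_cases h5 : p.1.valMinAbs = 5
  · have h := th_good_aux _ p.2.valMinAbs h1 h2 (fun n => a n) ha {0, -1} (by
      intro n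
      rw [h5]
      simp
      omega)
    exact ⟨_, _, h.pow 200⟩
  · have h := th_good_aux _ p.2.valMinAbs h1 h2 (fun n => a n) ha {0} (by
      intro n
      simp
      omega)
    exact ⟨_, _, h.pow 200⟩

lemma one_add_unit {ζ : SInt} (h : 1 + ζ + ζ ^ 2 + ζ ^ 3 + ζ ^ 4 = 0) : IsUnit (1 + ζ) :=
  IsUnit.of_mul_eq_one (-((1 + ζ ^ 2) * ζ)) (by linear_combination -h)

lemma adm_five {p : ZMod 10 × ZMod 10} (hp : Adm p) (h5 : p.1.valMinAbs = 5) :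
    ∃ m : ℤ, p.2.valMinAbs = 2 * m ∧ ¬ (5 : ℤ) ∣ m := by
  have key : ∀ p : ZMod 10 × ZMod 10, Adm p → p.1.valMinAbs = 5 →
      p.2.valMinAbs % 2 = 0 ∧ p.2.valMinAbs % 10 ≠ 0 := by
    decide
  obtain ⟨h1, h2⟩ := key p hp h5
  exact ⟨p.2.valMinAbs / 2, by omega, by omega⟩

lemma thP_inv (p : ZMod 10 × ZMod 10) (hp : Adm p) :
    (∀ τ, thP p τ ≠ 0) ∧ (fun τ => (thP p τ)⁻¹) ∈ goodRing 200 := by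
  have main : (∀ τ, th p.1.valMinAbs p.2.valMinAbs τ ≠ 0) ∧
      ∃ k c, IsUnit c ∧ Good 200 k c (th p.1.valMinAbs p.2.valMinAbs) := by
    choose a ha ha1 using fun n : ℤ => exists_unit_exp ((10 * n + p.1.valMinAbs) * p.2.valMinAbs)
      (d := 100) (by norm_num)
    have hm := ZMod.valMinAbs_mem_Ioc p.1
    have h1 : -5 < p.1.valMinAbs := by have := hm.1; push_cast at this; omega
    have h2 : p.1.valMinAbs ≤ 5 := by have := hm.2; push_cast at this; omega
    by_cases h5 : p.1.valMinAbs = 5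
    · obtain ⟨m, hm1, hm2⟩ := adm_five hp h5
      obtain ⟨z, hz, hz1⟩ := exists_unit_exp m (d := 5) (by norm_num)
      have hz5 : ((z : SInt) : ℂ) ^ 5 = 1 := by
        rw [hz, ← Complex.exp_nat_mul]
        exact exp_int_eq_one m (by push_cast; ring)
      have hzne : ((z : SInt) : ℂ) ≠ 1 := by
        rw [hz, Ne, Complex.exp_eq_one_iff]
        rintro ⟨n, hn⟩
        apply hm2
        refine ⟨n, ?_⟩
        have hpi : (2 * Real.pi * Complex.I : ℂ) ≠ 0 := Complex.two_pi_I_ne_zero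
        have : (m : ℂ) = 5 * n := by
          apply mul_left_cancel₀ hpi
          push_cast at hn
          linear_combination 5 * hn
        exact_mod_cast this
      constructor
      · refine th_ne_zero _ _ h1 h2 fun _ hc => ?_
        have h3 : Complex.exp (-(2 * Real.pi * Complex.I * (p.2.valMinAbs / 10))) *
            ((z : SInt) : ℂ) = 1 := by
          rw [hz, ← Complex.exp_add, hm1]
          exact exp_int_eq_one 0 (by push_cast; ring)
        rw [hc] at h3
        have h4 : ((z : SInt) : ℂ) = -1 := by linear_combination -h3
        rw [h4] at hz5
        norm_num at hz5
      · have h := th_good_aux _ p.2.valMinAbs h1 h2 (fun n => a n) ha {0, -1} (by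
          intro n
          rw [h5]
          simp
          omega)
        refine ⟨_, _, ?_, h⟩
        have hs : (∑ n ∈ ({0, -1} : Finset ℤ), ((a n : SIntˣ) : SInt)) = a (-1) * (1 + z) := by
          rw [Finset.sum_pair (by norm_num), mul_add, mul_one, add_comm]
          congr 1
          apply Subtype.ext
          change ((a 0 : SInt) : ℂ) = ((a (-1) : SInt) : ℂ) * ((z : SInt) : ℂ)
          rw [ha, ha, hz, ← Complex.exp_add, h5, hm1]
          congr 1
          push_cast
          ring
        rw [hs]
        refine (Units.isUnit _).mul (one_add_unit ?_)
        apply Subtype.ext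
        change 1 + ((z : SInt) : ℂ) + ((z : SInt) : ℂ) ^ 2 + ((z : SInt) : ℂ) ^ 3 +
          ((z : SInt) : ℂ) ^ 4 = 0
        apply mul_left_cancel₀ (sub_ne_zero.mpr hzne)
        linear_combination hz5
    · constructor
      · exact th_ne_zero _ _ h1 h2 fun h => absurd h h5
      · have h := th_good_aux _ p.2.valMinAbs h1 h2 (fun n => a n) ha {0} (by
          intro n
          simp
          omega)
        refine ⟨_, _, ?_, h⟩
        rw [Finset.sum_singleton]
        exact Units.isUnit _
  obtain ⟨h0, k, c, ⟨u, rfl⟩, hg⟩ := main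
  refine ⟨fun τ => pow_ne_zero _ (h0 τ), ?_⟩
  have h := (hg.inv (by norm_num) _ (Units.mul_inv u) h0).pow 200
  have e : (fun τ => (thP p τ)⁻¹) = (fun τ => (th p.1.valMinAbs p.2.valMinAbs τ)⁻¹) ^ 200 := by
    funext τ
    simp [thP]
  rw [e]
  exact ⟨_, _, h⟩

/-- The `S` action on indices. -/
def permS : Equiv.Perm (ZMod 10 × ZMod 10) where
  toFun p := (p.2, -p.1)
  invFun p := (-p.2, p.1)
  left_inv p := by simp
  right_inv p := by simp

/-- The `T` action on indices. -/
def permT : Equiv.Perm (ZMod 10 × ZMod 10) where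
  toFun p := (p.1, p.2 + p.1 + 5)
  invFun p := (p.1, p.2 - p.1 - 5)
  left_inv p := by
    ext
    · rfl
    · change _ = p.2
      ring
  right_inv p := by
    ext
    · rfl
    · change _ = p.2
      ring

lemma adm_S (p : ZMod 10 × ZMod 10) : Adm (permS p) ↔ Adm p := by
  revert p; decide

lemma adm_T (p : ZMod 10 × ZMod 10) : Adm (permT p) ↔ Adm p := by
  revert p; decide

lemma theta_quot_integral {τ : UpperHalfPlane} (hτ : IsIntegral ℤ (jfun τ))
    (p r : ZMod 10 × ZMod 10) (hr : Adm r) : IsIntegral ℤ (thP p τ / thP r τ) := by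
  have := integral_of_family jfun_good jfun_inv (N := 200) (by norm_num)
    (ι := (ZMod 10 × ZMod 10) × {r // Adm r}) (fun i τ => thP i.1 τ * (thP i.2.1 τ)⁻¹)
    (fun i => (goodRing 200).mul_mem (thP_mem i.1) (thP_inv i.2.1 i.2.2).2)
    (permS.prodCongr (permS.subtypePerm adm_S)) (permT.prodCongr (permT.subtypePerm adm_T))
    (fun i τ => by
      have h0 : (-Complex.I * (τ : ℂ)) ^ (1 / 2 : ℂ) ≠ 0 := by
        rw [Complex.cpow_ne_zero_iff]
        left
        exact mul_ne_zero (neg_ne_zero.mpr Complex.I_ne_zero) τ.ne_zero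
      have h1 := pow_ne_zero 200 h0
      change _ = thP (i.1.2, -i.1.1) τ * (thP (i.2.1.2, -i.2.1.1) τ)⁻¹
      rw [thP_S, thP_S, mul_inv, mul_mul_mul_comm, mul_inv_cancel₀ h1, one_mul])
    (fun i τ => by
      change _ = thP (i.1.1, i.1.2 + i.1.1 + 5) τ * (thP (i.2.1.1, i.2.1.2 + i.2.1.1 + 5) τ)⁻¹
      rw [thP_T, thP_T]) hτ (p, ⟨r, hr⟩)
  rw [div_eq_mul_inv]
  exact this

end ThetaChar

end Part7

section Part8
section Final

/-- The point `10 τ`. -/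
noncomputable def tenτ (τ : UpperHalfPlane) : UpperHalfPlane :=
  UpperHalfPlane.mk (10 * (τ : ℂ)) (by
    have := τ.im_pos
    simp
    exact this)

lemma tenτ_coe (τ : UpperHalfPlane) : (tenτ τ : ℂ) = 10 * (τ : ℂ) := rfl

lemma jfun_ten {τ : UpperHalfPlane} (hτ : IsImagQuadratic τ) : IsIntegral ℤ (jfun (tenτ τ)) := by
  obtain ⟨a, b, c, ha, h⟩ := hτ
  refine jfun_integral ⟨a, 10 * b, 100 * c, ha, ?_⟩
  rw [tenτ_coe]
  push_cast
  linear_combination 100 * h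

lemma th_prod (c d : ℕ) (hd : c + d = 5) (τ : UpperHalfPlane) :
    th c 5 (tenτ τ) = Complex.exp (Real.pi * Complex.I * (c / 10)) *
      Complex.exp (Real.pi * Complex.I * τ * (c ^ 2 / 10)) *
      ((∏' n : ℕ, (1 - (Qc τ ^ 10) ^ (n + 1))) *
        (qPoch (Qc τ ^ (5 + c)) (Qc τ ^ 10) * qPoch (Qc τ ^ d) (Qc τ ^ 10))) := by
  have hQ : Qc τ ≠ 0 := Complex.exp_ne_zero _
  have hdc : (c : ℂ) + d = 5 := by exact_mod_cast hd
  have hw : -Qc τ ^ c = Complex.exp (2 * Real.pi * Complex.I *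
      (((5 : ℤ) : ℂ) / 10 + ((c : ℤ) : ℂ) / 10 * (tenτ τ : ℂ))) := by
    rw [Qc, ← Complex.exp_nat_mul, ← neg_one_mul, ← Complex.exp_pi_mul_I, ← Complex.exp_add,
      tenτ_coe]
    congr 1
    push_cast
    ring
  have hq : Qc τ ^ 5 = Complex.exp (Real.pi * Complex.I * (tenτ τ : ℂ)) := by
    rw [Qc, ← Complex.exp_nat_mul, tenτ_coe]
    congr 1
    push_cast
    ring
  rw [th, theta_product _ (tenτ τ).im_pos hq hw, ← Complex.exp_add, qPoch, qPoch]
  congr 1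
  · rw [tenτ_coe]
    congr 1
    push_cast
    ring
  · rw [← pow_mul]
    congr 2
    · apply tprod_congr
      intro k
      ring
    · apply tprod_congr
      intro k
      have : Qc τ ^ d * Qc τ ^ c = Qc τ ^ 5 := by rw [← pow_add, add_comm, hd]
      have hc : Qc τ ^ c ≠ 0 := pow_ne_zero _ hQ
      have h2 : (Qc τ ^ 5) ^ (2 * k + 1) = Qc τ ^ d * Qc τ ^ c * (Qc τ ^ 10) ^ k := by
        rw [this]; ring
      rw [h2]
      field_simp
      ring

lemma euler_Q_ne (τ : UpperHalfPlane) : (∏' n : ℕ, (1 - (Qc τ ^ 10) ^ (n + 1))) ≠ 0 := by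
  apply fP_lim_ne
  have h : ‖Qc τ‖ < 1 := by
    rw [Qc, Complex.norm_exp]
    simp
    positivity
  rw [norm_pow]
  exact pow_lt_one₀ (norm_nonneg _) h (by norm_num)

lemma th_int {τ : UpperHalfPlane} (hτ : IsImagQuadratic τ) (c c' : ℕ)
    (hr : Adm (((c' : ℤ) : ZMod 10), ((5 : ℤ) : ZMod 10))) :
    IsIntegral ℤ (th c 5 (tenτ τ) / th c' 5 (tenτ τ)) := by
  have h := theta_quot_integral (jfun_ten hτ) (((c : ℤ) : ZMod 10), ((5 : ℤ) : ZMod 10)) _ hr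
  rw [thP_cast, thP_cast, ← div_pow] at h
  exact IsIntegral.of_pow (by norm_num) h

lemma exp_unit_integral (x : ℤ) : IsIntegral ℤ (Complex.exp (Real.pi * Complex.I * (x / 10))) := by
  refine IsIntegral.of_pow (n := 20) (by norm_num) ?_
  rw [← Complex.exp_nat_mul, exp_int_eq_one x (by push_cast; ring)]
  exact isIntegral_one

lemma J_integral (τ : UpperHalfPlane) (hτ : IsImagQuadratic τ) : IsIntegral ℤ (Jfun τ) := by
  have h := (exp_unit_integral (-1)).mul (th_int hτ 3 2 (by decide))
  rw [th_prod 3 2 rfl, th_prod 2 3 rfl] at h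
  have hE := euler_Q_ne τ
  refine (congrArg (IsIntegral ℤ) ?_).mpr h
  rw [Jfun]
  have e1 : Complex.exp (2 * Real.pi * Complex.I * τ * (1 / 4)) *
      Complex.exp (Real.pi * Complex.I * τ * (((2 : ℕ) : ℂ) ^ 2 / 10)) =
      Complex.exp (Real.pi * Complex.I * τ * (((3 : ℕ) : ℂ) ^ 2 / 10)) := by
    rw [← Complex.exp_add]; congr 1; push_cast; ring
  have e2 : Complex.exp (Real.pi * Complex.I * (((2 : ℕ) : ℂ) / 10)) =
      Complex.exp (Real.pi * Complex.I * (((-1 : ℤ) : ℂ) / 10)) *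
      Complex.exp (Real.pi * Complex.I * (((3 : ℕ) : ℂ) / 10)) := by
    rw [← Complex.exp_add]; congr 1; push_cast; ring
  rw [← e1, e2]
  have n1 := Complex.exp_ne_zero (Real.pi * Complex.I * (((-1 : ℤ) : ℂ) / 10))
  have n2 := Complex.exp_ne_zero (Real.pi * Complex.I * (((3 : ℕ) : ℂ) / 10))
  have n3 := Complex.exp_ne_zero (Real.pi * Complex.I * τ * (((2 : ℕ) : ℂ) ^ 2 / 10))
  generalize Complex.exp (Real.pi * Complex.I * (((-1 : ℤ) : ℂ) / 10)) = A at *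
  generalize Complex.exp (Real.pi * Complex.I * (((3 : ℕ) : ℂ) / 10)) = B at *
  generalize Complex.exp (Real.pi * Complex.I * τ * (((2 : ℕ) : ℂ) ^ 2 / 10)) = C at *
  generalize (∏' n : ℕ, (1 - (Qc τ ^ 10) ^ (n + 1))) = E at *
  norm_num only
  rw [show ∀ X Y Z : ℂ, A * (B * (X * C) * (E * Y) / (A * B * C * (E * Z))) =
    ((A * B * C * E) / (A * B * C * E)) * (X * Y / Z) by intro X Y Z; ring_nf]
  rw [div_self (by positivity), one_mul]
  ring

lemma I_integral (τ : UpperHalfPlane) (hτ : IsImagQuadratic τ) : IsIntegral ℤ (1 / Ifun τ) := by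
  have h := (exp_unit_integral 3).mul (th_int hτ 1 4 (by decide))
  rw [th_prod 1 4 rfl, th_prod 4 1 rfl] at h
  have hE := euler_Q_ne τ
  refine (congrArg (IsIntegral ℤ) ?_).mpr h
  rw [Ifun]
  have e1 : Complex.exp (2 * Real.pi * Complex.I * τ * (3 / 4)) *
      Complex.exp (Real.pi * Complex.I * τ * (((1 : ℕ) : ℂ) ^ 2 / 10)) =
      Complex.exp (Real.pi * Complex.I * τ * (((4 : ℕ) : ℂ) ^ 2 / 10)) := by
    rw [← Complex.exp_add]; congr 1; push_cast; ring
  have e2 : Complex.exp (Real.pi * Complex.I * (((4 : ℕ) : ℂ) / 10)) =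
      Complex.exp (Real.pi * Complex.I * (((3 : ℤ) : ℂ) / 10)) *
      Complex.exp (Real.pi * Complex.I * (((1 : ℕ) : ℂ) / 10)) := by
    rw [← Complex.exp_add]; congr 1; push_cast; ring
  rw [← e1, e2]
  have n1 := Complex.exp_ne_zero (Real.pi * Complex.I * (((3 : ℤ) : ℂ) / 10))
  have n2 := Complex.exp_ne_zero (Real.pi * Complex.I * (((1 : ℕ) : ℂ) / 10))
  have n3 := Complex.exp_ne_zero (Real.pi * Complex.I * τ * (((1 : ℕ) : ℂ) ^ 2 / 10))
  generalize Complex.exp (Real.pi * Complex.I * (((3 : ℤ) : ℂ) / 10)) = A at *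
  generalize Complex.exp (Real.pi * Complex.I * (((1 : ℕ) : ℂ) / 10)) = B at *
  generalize Complex.exp (Real.pi * Complex.I * τ * (((1 : ℕ) : ℂ) ^ 2 / 10)) = C at *
  generalize (∏' n : ℕ, (1 - (Qc τ ^ 10) ^ (n + 1))) = E at *
  norm_num only
  rw [show ∀ X Y Z : ℂ, A * (B * C * (E * Y) / (A * B * (X * C) * (E * Z))) =
    ((A * B * C * E) / (A * B * C * E)) * (Y / (X * Z)) by intro X Y Z; ring_nf]
  rw [div_self (by positivity), one_mul, one_div_div]
  rw [pow_one]
  ring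

end Final

end Part8

/-- If `τ ∈ ℍ` is an imaginary quadratic point, then `J(τ)` and `1/I(τ)` are algebraic
integers. -/
theorem statement18 (τ : UpperHalfPlane) (hτ : IsImagQuadratic τ) :
    IsIntegral ℤ (Jfun τ) ∧ IsIntegral ℤ (1 / Ifun τ) :=
  ⟨J_integral τ hτ, I_integral τ hτ⟩
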